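/- Let P = ∂_t − L with L periodic and c continuous, and let f be almost periodic on ℝ^{N+1}. If u is a bounded solution of Pu = f on ℝ^N × ℝ, then: (i) if λ_p(−L) ≥ 0 then u is almost periodic; (ii) if λ_p(−L) = 0 and either f ≤ 0 everywhere or f ≥ 0 everywhere, then u ≡ k φ_p for some real constant k and f ≡ 0. -/

import Mathlib

open Filter Topology

noncomputable section

/-- First-order spatial partial derivative in the direction `i`. -/
def pd {N : ℕ} (i : Fin N) (φ : (Fin N → ℝ) → ℝ) (x : Fin N → ℝ) : ℝ :=
  fderiv ℝ φ x (Pi.single i 1)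

/-- Second-order spatial partial derivative `∂ᵢⱼ`. -/
def pd2 {N : ℕ} (i j : Fin N) (φ : (Fin N → ℝ) → ℝ) (x : Fin N → ℝ) : ℝ :=
  pd i (fun y => pd j φ y) x

/-- The parabolic operator `P u = ∂ₜ u − aᵢⱼ ∂ᵢⱼ u − bᵢ ∂ᵢ u − c u`. -/
def parOp {N : ℕ} (a : Fin N → Fin N → (Fin N → ℝ) → ℝ → ℝ)
    (b : Fin N → (Fin N → ℝ) → ℝ → ℝ) (c : (Fin N → ℝ) → ℝ → ℝ)
    (u : (Fin N → ℝ) → ℝ → ℝ) (x : Fin N → ℝ) (t : ℝ) : ℝ :=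
  deriv (fun s => u x s) t
    - (∑ i, ∑ j, a i j x t * pd2 i j (fun y => u y t) x)
    - (∑ i, b i x t * pd i (fun y => u y t) x)
    - c x t * u x t

/-- A bounded function on `ℝ^N × ℝ`. -/
def Bdd2 {N : ℕ} (φ : (Fin N → ℝ) → ℝ → ℝ) : Prop :=
  ∃ M : ℝ, ∀ x t, |φ x t| ≤ M

/-- A uniformly continuous function on `ℝ^N × ℝ`. -/
def UC2 {N : ℕ} (φ : (Fin N → ℝ) → ℝ → ℝ) : Prop :=
  UniformContinuous fun p : (Fin N → ℝ) × ℝ => φ p.1 p.2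

/-- Standing assumptions on the coefficients of `P`: `a`, `b` bounded and uniformly
continuous, `c` bounded and measurable, `(aᵢⱼ)` symmetric and uniformly elliptic. -/
def StdCoeffs {N : ℕ} (a : Fin N → Fin N → (Fin N → ℝ) → ℝ → ℝ)
    (b : Fin N → (Fin N → ℝ) → ℝ → ℝ) (c : (Fin N → ℝ) → ℝ → ℝ) : Prop :=
  (∀ i j, Bdd2 (a i j)) ∧ (∀ i j, UC2 (a i j)) ∧
  (∀ i, Bdd2 (b i)) ∧ (∀ i, UC2 (b i)) ∧
  Bdd2 c ∧ Measurable (fun p : (Fin N → ℝ) × ℝ => c p.1 p.2) ∧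
  (∀ i j x t, a i j x t = a j i x t) ∧
  (∃ a₀ a₁ : ℝ, 0 < a₀ ∧ a₀ ≤ a₁ ∧ ∀ (x : Fin N → ℝ) (t : ℝ) (ξ : Fin N → ℝ),
    a₀ * ∑ i, ξ i ^ 2 ≤ ∑ i, ∑ j, a i j x t * ξ i * ξ j ∧
    ∑ i, ∑ j, a i j x t * ξ i * ξ j ≤ a₁ * ∑ i, ξ i ^ 2)

/-- Regularity required of entire solutions (classical reading of the notion of
solution used in the paper). -/
def RegSol {N : ℕ} (u : (Fin N → ℝ) → ℝ → ℝ) : Prop :=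
  Continuous (fun p : (Fin N → ℝ) × ℝ => u p.1 p.2) ∧
  (∀ x, Differentiable ℝ fun s => u x s) ∧
  (∀ t, ContDiff ℝ 2 fun y => u y t)

/-- `u` is an entire solution of `P u = f` on `ℝ^N × ℝ`. -/
def IsSol {N : ℕ} (a : Fin N → Fin N → (Fin N → ℝ) → ℝ → ℝ)
    (b : Fin N → (Fin N → ℝ) → ℝ → ℝ) (c : (Fin N → ℝ) → ℝ → ℝ)
    (f u : (Fin N → ℝ) → ℝ → ℝ) : Prop :=
  RegSol u ∧ ∀ x t, parOp a b c u x t = f x t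

/-- Periodicity, with period `l`, in the `m`-th of the `N+1` space-time variables:
if `m ≤ N` this is periodicity in the space direction `x_m`, if `m = N+1` it is
periodicity in time. -/
def PerInVar {N : ℕ} (m : Fin (N + 1)) (l : ℝ) (φ : (Fin N → ℝ) → ℝ → ℝ) : Prop :=
  if h : (m : ℕ) < N then ∀ x t, φ (x + Pi.single (⟨(m : ℕ), h⟩ : Fin N) l) t = φ x t
  else ∀ x t, φ x (t + l) = φ x t
/-- Full space-time periodicity with space periods `l i` and time period `τ`. -/
def PerAll {N : ℕ} (l : Fin N → ℝ) (τ : ℝ) (φ : (Fin N → ℝ) → ℝ → ℝ) : Prop :=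
  (∀ (i : Fin N) (x : Fin N → ℝ) (t : ℝ), φ (x + Pi.single i (l i)) t = φ x t) ∧
  (∀ (x : Fin N → ℝ) (t : ℝ), φ x (t + τ) = φ x t)

/-- The elliptic operator `L φ = Aᵢⱼ ∂ᵢⱼ φ + Bᵢ ∂ᵢ φ + C φ` (time-independent
coefficients). -/
def ellOp {N : ℕ} (A : Fin N → Fin N → (Fin N → ℝ) → ℝ)
    (B : Fin N → (Fin N → ℝ) → ℝ) (C : (Fin N → ℝ) → ℝ)
    (φ : (Fin N → ℝ) → ℝ) (x : Fin N → ℝ) : ℝ :=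
  (∑ i, ∑ j, A i j x * pd2 i j φ x) + (∑ i, B i x * pd i φ x) + C x * φ x

/-- A function on `ℝ^N` periodic with period `(l 1, …, l N)`. -/
def PerSpaceFun {N : ℕ} (l : Fin N → ℝ) (ψ : (Fin N → ℝ) → ℝ) : Prop :=
  ∀ (i : Fin N) (x : Fin N → ℝ), ψ (x + Pi.single i (l i)) = ψ x

/-- `(lam, φ)` is the periodic principal eigenpair of `−L` in `ℝ^N`:
`φ` is positive, periodic (with the periods of `L`) and `−Lφ = lam • φ`. -/
def IsPerPrincipal {N : ℕ} (A : Fin N → Fin N → (Fin N → ℝ) → ℝ)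
    (B : Fin N → (Fin N → ℝ) → ℝ) (C : (Fin N → ℝ) → ℝ)
    (l : Fin N → ℝ) (lam : ℝ) (φ : (Fin N → ℝ) → ℝ) : Prop :=
  ContDiff ℝ 2 φ ∧ (∀ x, 0 < φ x) ∧ PerSpaceFun l φ ∧
  ∀ x, -(ellOp A B C φ x) = lam * φ x
/-- A continuous function on `ℝ^N × ℝ` is almost periodic (Bochner's
characterization): from every sequence of space-time translations one can extract
a subsequence along which the translates converge uniformly. -/
def APfun {N : ℕ} (φ : (Fin N → ℝ) × ℝ → ℝ) : Prop :=
  Continuous φ ∧ ∀ S : ℕ → (Fin N → ℝ) × ℝ, ∃ k : ℕ → ℕ, StrictMono k ∧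
    ∃ ψ : (Fin N → ℝ) × ℝ → ℝ, TendstoUniformly (fun n X => φ (X + S (k n))) ψ atTop

/-- Second derivative test via symmetric second differences. -/
lemma second_diff_le {g g' : ℝ → ℝ} {g2 c : ℝ} (hg : ∀ s, HasDerivAt g (g' s) s)
    (hg' : HasDerivAt g' g2 0)
    (h : ∀ᶠ s in 𝓝 (0:ℝ), g s + g (-s) - 2 * g 0 ≤ c * s ^ 2) : g2 ≤ c := by
  by_contra hlt
  push Not at hlt
  set k : ℝ → ℝ := fun s => g s + g (-s) - c * s ^ 2 with hk
  have hk1 : ∀ s, HasDerivAt k (g' s - g' (-s) - 2 * c * s) s := by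
    intro s
    have h1 : HasDerivAt (fun s => g (-s)) (-(g' (-s))) s := by
      exact (HasDerivAt.comp s (hg (-s)) (hasDerivAt_neg s)).congr_deriv (by ring)
    have h2 : HasDerivAt (fun s : ℝ => c * s ^ 2) (c * (2 * s)) s := by
      simpa using (hasDerivAt_pow 2 s).const_mul c
    exact (((hg s).add h1).sub h2).congr_deriv (by ring)
  have hd : deriv k = fun s => g' s - g' (-s) - 2 * c * s := funext fun s => (hk1 s).deriv
  have hk2 : HasDerivAt (deriv k) (2 * g2 - 2 * c) 0 := by
    rw [hd]
    have h1 : HasDerivAt (fun s => g' (-s)) (-g2) 0 := by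
      have : HasDerivAt g' g2 (-0) := by simpa using hg'
      exact (HasDerivAt.comp (0:ℝ) this (hasDerivAt_neg (0:ℝ))).congr_deriv (by ring)
    have h2 : HasDerivAt (fun s : ℝ => 2 * c * s) (2 * c) 0 := by
      simpa using (hasDerivAt_id (0:ℝ)).const_mul (2 * c)
    exact ((hg'.sub h1).sub h2).congr_deriv (by ring)
  have hmin : IsLocalMin k 0 := by
    apply isLocalMin_of_deriv_deriv_pos
    · rw [hk2.deriv]; linarith
    · rw [hd]; simp
    · exact (hk1 0).continuousAt
  have hmax : ∀ᶠ s in 𝓝 (0:ℝ), k s = k 0 := by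
    filter_upwards [h, hmin] with s h1 h2
    simp only [hk] at h2 ⊢
    simp only [neg_zero] at h2 ⊢
    nlinarith
  have h3 : deriv k =ᶠ[𝓝 0] fun _ => 0 := by
    have : k =ᶠ[𝓝 0] fun _ => k 0 := hmax
    have := this.deriv
    simpa using this
  have h4 := h3.deriv_eq
  rw [hk2.deriv] at h4
  simp at h4
  linarith

lemma left_deriv_nonneg {g : ℝ → ℝ} {d t : ℝ} (hg : HasDerivAt g d t)
    (h : ∀ᶠ s in 𝓝[<] t, g s ≤ g t) : 0 ≤ d := by
  have h1 := (hasDerivAt_iff_tendsto_slope.1 hg).mono_left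
    (nhdsWithin_mono t (fun s (hs : s < t) => hs.ne) : 𝓝[<] t ≤ 𝓝[≠] t)
  refine ge_of_tendsto h1 ?_
  filter_upwards [h, self_mem_nhdsWithin] with s hs hst
  rw [slope_def_field]
  have : s < t := hst
  exact div_nonneg_of_nonpos (by linarith) (by linarith)

/-- The quadratic form of the Hessian. -/
def hess {N : ℕ} (φ : (Fin N → ℝ) → ℝ) (x ξ : Fin N → ℝ) : ℝ :=
  ∑ i, ∑ j, ξ i * ξ j * pd2 i j φ x

lemma fderiv_eq_sum {N : ℕ} (φ : (Fin N → ℝ) → ℝ) (x ξ : Fin N → ℝ) :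
    fderiv ℝ φ x ξ = ∑ i, ξ i * pd i φ x := by
  conv_lhs => rw [pi_eq_sum_univ' ξ]
  rw [map_sum]
  refine Finset.sum_congr rfl fun i _ => ?_
  rw [map_smul, smul_eq_mul, pd]

lemma line_deriv {N : ℕ} {φ : (Fin N → ℝ) → ℝ} (hφ : Differentiable ℝ φ) (x ξ : Fin N → ℝ) (s : ℝ) :
    HasDerivAt (fun s : ℝ => φ (x + s • ξ)) (∑ i, ξ i * pd i φ (x + s • ξ)) s := by
  rw [← fderiv_eq_sum]
  have h1 : HasDerivAt (fun s : ℝ => x + s • ξ) ξ s := by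
    simpa using ((hasDerivAt_id s).smul_const ξ).const_add x
  exact (hφ (x + s • ξ)).hasFDerivAt.comp_hasDerivAt s h1

lemma pd_contDiff {N : ℕ} {φ : (Fin N → ℝ) → ℝ} (hφ : ContDiff ℝ 2 φ) (i : Fin N) :
    ContDiff ℝ 1 (fun y => pd i φ y) := by
  unfold pd
  exact (hφ.fderiv_right (by norm_num)).clm_apply contDiff_const

lemma line_deriv2 {N : ℕ} {φ : (Fin N → ℝ) → ℝ} (hφ : ContDiff ℝ 2 φ) (x ξ : Fin N → ℝ) (s : ℝ) :
    HasDerivAt (fun s : ℝ => ∑ i, ξ i * pd i φ (x + s • ξ)) (hess φ (x + s • ξ) ξ) s := by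
  have : hess φ (x + s • ξ) ξ = ∑ j, ξ j * ∑ i, ξ i * pd i (fun y => pd j φ y) (x + s • ξ) := by
    unfold hess pd2
    rw [Finset.sum_comm]
    refine Finset.sum_congr rfl fun j _ => ?_
    rw [Finset.mul_sum]
    refine Finset.sum_congr rfl fun i _ => ?_
    ring
  rw [this]
  apply HasDerivAt.fun_sum
  intro j _
  exact (line_deriv ((pd_contDiff hφ j).differentiable (by norm_num)) x ξ s).const_mul _

/-- `A` positive semidefinite and symmetric against a nonnegative form. -/
lemma trace_nonneg {N : ℕ} (S T : Fin N → Fin N → ℝ) (hsym : ∀ i j, S i j = S j i)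
    (hS : ∀ ξ : Fin N → ℝ, 0 ≤ ∑ i, ∑ j, S i j * ξ i * ξ j)
    (hT : ∀ ξ : Fin N → ℝ, 0 ≤ ∑ i, ∑ j, ξ i * ξ j * T i j) :
    0 ≤ ∑ i, ∑ j, S i j * T i j := by
  have hp : (Matrix.of S).PosSemidef := by
    refine Matrix.PosSemidef.of_dotProduct_mulVec_nonneg ?_ ?_
    · ext i j; simp [hsym i j]
    · intro x
      refine le_of_le_of_eq (hS x) ?_
      symm
      change ∑ i, x i * ∑ j, S i j * x j = _
      simp only [Finset.mul_sum]
      refine Finset.sum_congr rfl fun i _ => Finset.sum_congr rfl fun j _ => ?_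
      ring
  obtain ⟨b, hb⟩ : ∃ b : Matrix (Fin N) (Fin N) ℝ, Matrix.of S = b.conjTranspose * b := by
    open scoped MatrixOrder Matrix.Norms.L2Operator in
    exact CStarAlgebra.nonneg_iff_eq_star_mul_self.mp hp.nonneg
  have hS' : ∀ i j, S i j = ∑ k, b k i * b k j := by
    intro i j
    have := congrFun (congrFun hb i) j
    simpa [Matrix.mul_apply] using this
  have : ∑ i, ∑ j, S i j * T i j = ∑ k, ∑ i, ∑ j, b k i * b k j * T i j := by
    simp_rw [hS', Finset.sum_mul]
    conv_lhs =>
      enter [2, i]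
      rw [Finset.sum_comm]
    rw [Finset.sum_comm]
  rw [this]
  exact Finset.sum_nonneg fun k _ => hT (fun i => b k i)

/-- The operator `∂ₜ - A D² - B D`. -/
def qOp {N : ℕ} (A : Fin N → Fin N → (Fin N → ℝ) → ℝ) (B : Fin N → (Fin N → ℝ) → ℝ)
    (u : (Fin N → ℝ) → ℝ → ℝ) (x : Fin N → ℝ) (t : ℝ) : ℝ :=
  deriv (fun s => u x s) t
    - (∑ i, ∑ j, A i j x * pd2 i j (fun y => u y t) x)
    - (∑ i, B i x * pd i (fun y => u y t) x)

/-- Standing assumptions for `qOp`. -/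
structure QC {N : ℕ} (A : Fin N → Fin N → (Fin N → ℝ) → ℝ) (B : Fin N → (Fin N → ℝ) → ℝ)
    (a₀ CA CB : ℝ) : Prop where
  pos : 0 < a₀
  symm : ∀ i j x, A i j x = A j i x
  ell : ∀ (x ξ : Fin N → ℝ), a₀ * ∑ i, ξ i ^ 2 ≤ ∑ i, ∑ j, A i j x * ξ i * ξ j
  bA : ∀ i j x, |A i j x| ≤ CA
  bB : ∀ i x, |B i x| ≤ CB
  CA0 : 0 ≤ CA
  CB0 : 0 ≤ CB

lemma QC.psd {N : ℕ} {A : Fin N → Fin N → (Fin N → ℝ) → ℝ} {B : Fin N → (Fin N → ℝ) → ℝ}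
    {a₀ CA CB : ℝ} (h : QC A B a₀ CA CB) (x ξ : Fin N → ℝ) :
    0 ≤ ∑ i, ∑ j, A i j x * ξ i * ξ j :=
  le_trans (mul_nonneg h.pos.le (Finset.sum_nonneg fun _ _ => sq_nonneg _)) (h.ell x ξ)

/-- Regularity in `x` and `t` separately (no joint continuity). -/
def Reg0 {N : ℕ} (u : (Fin N → ℝ) → ℝ → ℝ) : Prop :=
  (∀ x, Differentiable ℝ fun s => u x s) ∧ (∀ t, ContDiff ℝ 2 fun y => u y t)

lemma pd_sub {N : ℕ} {φ ψ : (Fin N → ℝ) → ℝ} (h1 : ContDiff ℝ 1 φ) (h2 : ContDiff ℝ 1 ψ)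
    (i : Fin N) (x : Fin N → ℝ) : pd i (fun y => φ y - ψ y) x = pd i φ x - pd i ψ x := by
  unfold pd
  rw [fderiv_fun_sub (h1.differentiable (by norm_num) x) (h2.differentiable (by norm_num) x)]
  rfl

lemma pd2_sub {N : ℕ} {φ ψ : (Fin N → ℝ) → ℝ} (h1 : ContDiff ℝ 2 φ) (h2 : ContDiff ℝ 2 ψ)
    (i j : Fin N) (x : Fin N → ℝ) :
    pd2 i j (fun y => φ y - ψ y) x = pd2 i j φ x - pd2 i j ψ x := by
  unfold pd2
  rw [← pd_sub (pd_contDiff h1 j) (pd_contDiff h2 j)]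
  congr 1
  ext y
  exact pd_sub (h1.of_le (by norm_num)) (h2.of_le (by norm_num)) j y

lemma Reg0.sub {N : ℕ} {u v : (Fin N → ℝ) → ℝ → ℝ} (hu : Reg0 u) (hv : Reg0 v) :
    Reg0 (fun x t => u x t - v x t) :=
  ⟨fun x => (hu.1 x).fun_sub (hv.1 x), fun t => (hu.2 t).sub (hv.2 t)⟩

lemma qOp_sub {N : ℕ} (A : Fin N → Fin N → (Fin N → ℝ) → ℝ) (B : Fin N → (Fin N → ℝ) → ℝ)
    {u v : (Fin N → ℝ) → ℝ → ℝ} (hu : Reg0 u) (hv : Reg0 v) (x : Fin N → ℝ) (t : ℝ) :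
    qOp A B (fun x t => u x t - v x t) x t = qOp A B u x t - qOp A B v x t := by
  unfold qOp
  rw [deriv_fun_sub (hu.1 x t) (hv.1 x t)]
  simp_rw [pd2_sub (hu.2 t) (hv.2 t), pd_sub ((hu.2 t).of_le (by norm_num : (1:WithTop ℕ∞) ≤ 2))
    ((hv.2 t).of_le (by norm_num : (1:WithTop ℕ∞) ≤ 2)), mul_sub, Finset.sum_sub_distrib]
  ring

lemma reg0_const {N : ℕ} (k : ℝ) : Reg0 (fun (_ : Fin N → ℝ) (_ : ℝ) => k) :=
  ⟨fun _ => differentiable_const k, fun _ => contDiff_const⟩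

lemma qOp_const {N : ℕ} (A : Fin N → Fin N → (Fin N → ℝ) → ℝ) (B : Fin N → (Fin N → ℝ) → ℝ)
    (k : ℝ) (x : Fin N → ℝ) (t : ℝ) : qOp A B (fun _ _ => k) x t = 0 := by
  have h : ∀ (i : Fin N) (c : ℝ) (x : Fin N → ℝ), pd i (fun _ => c) x = 0 := by
    intro i c x; simp [pd]
  simp [qOp, pd2, h]

/-- Touching lemma: at a (parabolic) local maximum `qOp` is nonnegative. -/
lemma qOp_nonneg_of_max {N : ℕ} {A : Fin N → Fin N → (Fin N → ℝ) → ℝ}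
    {B : Fin N → (Fin N → ℝ) → ℝ} {a₀ CA CB : ℝ} (hQ : QC A B a₀ CA CB)
    {w : (Fin N → ℝ) → ℝ → ℝ} (hw : Reg0 w) (x : Fin N → ℝ) (t : ℝ)
    (hx : ∀ᶠ y in 𝓝 x, w y t ≤ w x t) (ht : ∀ᶠ s in 𝓝[<] t, w x s ≤ w x t) :
    0 ≤ qOp A B w x t := by
  have h1 : 0 ≤ deriv (fun s => w x s) t := left_deriv_nonneg (hw.1 x t).hasDerivAt ht
  have h2 : ∀ i, pd i (fun y => w y t) x = 0 := by
    intro i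
    have : IsLocalMax (fun y => w y t) x := hx
    simp [pd, this.fderiv_eq_zero]
  have h3 : ∀ ξ : Fin N → ℝ, hess (fun y => w y t) x ξ ≤ 0 := by
    intro ξ
    have e1 := line_deriv ((hw.2 t).differentiable (by norm_num)) x ξ
    have e2 := line_deriv2 (hw.2 t) x ξ 0
    simp only [zero_smul, add_zero] at e2
    refine second_diff_le e1 e2 ?_
    have c1 : Tendsto (fun s : ℝ => x + s • ξ) (𝓝 0) (𝓝 x) := by
      have : Continuous (fun s : ℝ => x + s • ξ) := by fun_prop
      simpa using this.tendsto 0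
    have c2 : Tendsto (fun s : ℝ => x + (-s) • ξ) (𝓝 0) (𝓝 x) := by
      have : Continuous (fun s : ℝ => x + (-s) • ξ) := by fun_prop
      simpa using this.tendsto 0
    filter_upwards [c1.eventually hx, c2.eventually hx] with s k1 k2
    simp only [zero_smul, add_zero]
    linarith
  have h4 := trace_nonneg (fun i j => A i j x) (fun i j => - pd2 i j (fun y => w y t) x)
    (fun i j => hQ.symm i j x) (fun ξ => hQ.psd x ξ) (fun ξ => by
      have := h3 ξ
      simp only [hess] at this
      simp only [mul_neg, Finset.sum_neg_distrib]
      linarith)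
  simp only [mul_neg, Finset.sum_neg_distrib] at h4
  unfold qOp
  simp only [h2, mul_zero, Finset.sum_const_zero]
  linarith


/-- Squared Euclidean distance. -/
def nn {N : ℕ} (a x : Fin N → ℝ) : ℝ := ∑ i, (x i - a i) ^ 2

lemma nn_nonneg {N : ℕ} (a x : Fin N → ℝ) : 0 ≤ nn a x := Finset.sum_nonneg fun _ _ => sq_nonneg _

lemma sq_le_nn {N : ℕ} (a x : Fin N → ℝ) (i : Fin N) : (x i - a i) ^ 2 ≤ nn a x :=
  Finset.single_le_sum (f := fun i => (x i - a i) ^ 2) (fun _ _ => sq_nonneg _) (Finset.mem_univ i)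

lemma abs_le_of_nn {N : ℕ} {a x : Fin N → ℝ} {ρ : ℝ} (hρ : 0 ≤ ρ) (h : nn a x ≤ ρ ^ 2) (i : Fin N) :
    |x i - a i| ≤ ρ := abs_le_of_sq_le_sq ((sq_le_nn a x i).trans h) hρ

lemma norm_le_of_nn {N : ℕ} {a x : Fin N → ℝ} {ρ : ℝ} (hρ : 0 ≤ ρ) (h : nn a x ≤ ρ ^ 2) :
    ‖x - a‖ ≤ ρ := by
  rw [pi_norm_le_iff_of_nonneg hρ]
  intro i
  simpa using abs_le_of_nn hρ h i

lemma nn_contDiff {N : ℕ} (a : Fin N → ℝ) : ContDiff ℝ 2 (nn a) := by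
  unfold nn; fun_prop

lemma nn_continuous {N : ℕ} : Continuous (fun p : (Fin N → ℝ) × (Fin N → ℝ) => nn p.1 p.2) := by
  unfold nn; fun_prop

lemma pd_mul {N : ℕ} {φ ψ : (Fin N → ℝ) → ℝ} (h1 : ContDiff ℝ 1 φ) (h2 : ContDiff ℝ 1 ψ)
    (i : Fin N) (x : Fin N → ℝ) :
    pd i (fun y => φ y * ψ y) x = pd i φ x * ψ x + φ x * pd i ψ x := by
  unfold pd
  rw [fderiv_fun_mul (h1.differentiable (by norm_num) x) (h2.differentiable (by norm_num) x)]
  simp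
  ring

lemma pd_add {N : ℕ} {φ ψ : (Fin N → ℝ) → ℝ} (h1 : ContDiff ℝ 1 φ) (h2 : ContDiff ℝ 1 ψ)
    (i : Fin N) (x : Fin N → ℝ) : pd i (fun y => φ y + ψ y) x = pd i φ x + pd i ψ x := by
  unfold pd
  rw [fderiv_fun_add (h1.differentiable (by norm_num) x) (h2.differentiable (by norm_num) x)]
  rfl

lemma pd_const {N : ℕ} (i : Fin N) (c : ℝ) (x : Fin N → ℝ) : pd i (fun _ => c) x = 0 := by
  simp [pd]

lemma pd_of_line {N : ℕ} {φ : (Fin N → ℝ) → ℝ} (h : ContDiff ℝ 1 φ) (i : Fin N) (x : Fin N → ℝ)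
    {d : ℝ} (hd : HasDerivAt (fun s : ℝ => φ (x + s • Pi.single i 1)) d 0) : pd i φ x = d := by
  have h1 := line_deriv (h.differentiable (by norm_num)) x (Pi.single i 1) 0
  have h2 := h1.unique hd
  rw [← h2]
  simp [Pi.single_apply]

lemma pd_coord {N : ℕ} (a : Fin N → ℝ) (i j : Fin N) (x : Fin N → ℝ) :
    pd i (fun y => y j - a j) x = if i = j then 1 else 0 := by
  apply pd_of_line (by fun_prop)
  have h := ((hasDerivAt_id (0:ℝ)).smul_const ((Pi.single i (1:ℝ) : Fin N → ℝ) j)).const_add (x j)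
  have h2 := h.sub_const (a j)
  refine h2.congr_deriv ?_
  simp [Pi.single_apply, eq_comm]

lemma pd_nn {N : ℕ} (a : Fin N → ℝ) (i : Fin N) (x : Fin N → ℝ) :
    pd i (nn a) x = 2 * (x i - a i) := by
  have e : ∀ s : Finset (Fin N), pd i (fun y => ∑ k ∈ s, (y k - a k) ^ 2) x
      = ∑ k ∈ s, 2 * (x k - a k) * (if i = k then 1 else 0) := by
    intro s
    induction s using Finset.induction_on with
    | empty => simp [pd_const]
    | insert k s hk ih =>
      simp_rw [Finset.sum_insert hk]
      rw [pd_add (by fun_prop) (by fun_prop), ih]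
      congr 1
      simp_rw [pow_two]
      rw [pd_mul (by fun_prop) (by fun_prop), pd_coord]
      ring
  have := e Finset.univ
  simp only [mul_ite, mul_one, mul_zero, Finset.sum_ite_eq, Finset.mem_univ, if_true] at this
  exact this

/-- The spatial derivatives of the quadratic-type barrier `α (r - nn)² + β`. -/
lemma pd_bar {N : ℕ} (a : Fin N → ℝ) (α β r : ℝ) (j : Fin N) (x : Fin N → ℝ) :
    pd j (fun y => α * (r - nn a y) ^ 2 + β) x = -4 * α * ((r - nn a x) * (x j - a j)) := by
  have hn := (nn_contDiff a).of_le (by norm_num : (1:WithTop ℕ∞) ≤ 2)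
  have h1 : ContDiff ℝ 1 (fun y => r - nn a y) := contDiff_const.sub hn
  rw [pd_add (contDiff_const.mul (h1.pow 2)) contDiff_const, pd_mul contDiff_const (h1.pow 2),
    pd_const, pd_const]
  simp_rw [pow_two]
  rw [pd_mul h1 h1, pd_sub contDiff_const hn, pd_const, pd_nn]
  ring

lemma pd2_bar {N : ℕ} (a : Fin N → ℝ) (α β r : ℝ) (i j : Fin N) (x : Fin N → ℝ) :
    pd2 i j (fun y => α * (r - nn a y) ^ 2 + β) x
      = -4 * α * (-2 * (x i - a i) * (x j - a j) + (r - nn a x) * (if i = j then 1 else 0)) := by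
  have hn := (nn_contDiff a).of_le (by norm_num : (1:WithTop ℕ∞) ≤ 2)
  have h1 : ContDiff ℝ 1 (fun y => r - nn a y) := contDiff_const.sub hn
  unfold pd2
  simp_rw [pd_bar]
  have h2 : ContDiff ℝ 1 (fun y : Fin N → ℝ => y j - a j) := by fun_prop
  rw [pd_mul contDiff_const (h1.mul h2), pd_mul h1 h2, pd_const, pd_sub contDiff_const hn,
    pd_const, pd_nn, pd_coord]
  ring

lemma pd2_nn {N : ℕ} (a : Fin N → ℝ) (α β : ℝ) (i j : Fin N) (x : Fin N → ℝ) :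
    pd2 i j (fun y => α * nn a y + β) x = 2 * α * (if i = j then 1 else 0) ∧
    pd j (fun y => α * nn a y + β) x = 2 * α * (x j - a j) := by
  have hn := (nn_contDiff a).of_le (by norm_num : (1:WithTop ℕ∞) ≤ 2)
  have h0 : ∀ x, pd j (fun y => α * nn a y + β) x = 2 * α * (x j - a j) := by
    intro x
    rw [pd_add (contDiff_const.mul hn) contDiff_const, pd_mul contDiff_const hn, pd_const,
      pd_const, pd_nn]
    ring
  refine ⟨?_, h0 x⟩
  unfold pd2
  simp_rw [h0]
  rw [pd_mul contDiff_const (by fun_prop), pd_const, pd_coord]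
  ring

lemma sum_abs_le {N : ℕ} {F : Fin N → ℝ} {C : ℝ} (h : ∀ i, |F i| ≤ C) : |∑ i, F i| ≤ N * C := by
  refine (Finset.abs_sum_le_sum_abs _ _).trans ?_
  refine (Finset.sum_le_sum fun i _ => h i).trans ?_
  simp

lemma barrier_arith {a₀ C1 ρ q κ X : ℝ} (ha : 0 < a₀) (hρ : 0 < ρ)
    (hκ : κ = (C1 + 8 * a₀) ^ 2 / (32 * a₀ * ρ ^ 2))
    (hX : X ≤ q * C1 - κ * q ^ 2 - 8 * a₀ * (ρ ^ 2 - q)) : X ≤ 0 := by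
  have h1 : 0 < 32 * a₀ * ρ ^ 2 := by positivity
  have h2 : κ * (32 * a₀ * ρ ^ 2) = (C1 + 8 * a₀) ^ 2 := by rw [hκ]; field_simp
  have h3 : 0 ≤ 32 * a₀ * ρ ^ 2 * (κ * q ^ 2 + 8 * a₀ * (ρ ^ 2 - q) - q * C1) := by
    have : 32 * a₀ * ρ ^ 2 * (κ * q ^ 2 + 8 * a₀ * (ρ ^ 2 - q) - q * C1)
      = ((C1 + 8 * a₀) * q - 16 * a₀ * ρ ^ 2) ^ 2 := by
      linear_combination q ^ 2 * h2
    rw [this]; positivity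
  have := nonneg_of_mul_nonneg_right h3 h1
  linarith

/-- The moving barrier. -/
def barr {N : ℕ} (c ρ κ δ s : ℝ) (y V : Fin N → ℝ) (x : Fin N → ℝ) (t : ℝ) : ℝ :=
  c * Real.exp (-κ * (t - s)) * (ρ ^ 2 - nn (y + (t - s) • V) x) ^ 2 + -(2 * δ * (t - s))

lemma barr_deriv {N : ℕ} (c ρ κ δ s : ℝ) (y V : Fin N → ℝ) (x : Fin N → ℝ) (t : ℝ) :
    HasDerivAt (fun t => barr c ρ κ δ s y V x t)
      (c * Real.exp (-κ * (t - s)) * (2 * (ρ ^ 2 - nn (y + (t - s) • V) x) *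
        (2 * ∑ i, (x i - (y + (t - s) • V) i) * V i) - κ * (ρ ^ 2 - nn (y + (t - s) • V) x) ^ 2)
        - 2 * δ) t := by
  have h0 : HasDerivAt (fun t : ℝ => t - s) 1 t := (hasDerivAt_id t).sub_const s
  have h1 : HasDerivAt (fun t => nn (y + (t - s) • V) x)
      (∑ i, 2 * (x i - (y + (t - s) • V) i) * (-V i)) t := by
    unfold nn
    apply HasDerivAt.fun_sum
    intro i _
    have h2 : HasDerivAt (fun t : ℝ => x i - (y + (t - s) • V) i) (-V i) t := by
      have := ((h0.mul_const (V i)).const_add (y i)).const_sub (x i)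
      simpa using this
    have := h2.pow 2
    refine this.congr_deriv ?_
    simp
  have h2 : HasDerivAt (fun t => Real.exp (-κ * (t - s))) (Real.exp (-κ * (t - s)) * (-κ * 1)) t :=
    (h0.const_mul (-κ)).exp
  have h3 := ((h2.const_mul c).mul ((h1.const_sub (ρ ^ 2)).pow 2)).add (h0.const_mul (2 * δ)).neg
  unfold barr
  refine h3.congr_deriv ?_
  have : ∑ i, 2 * (x i - (y + (t - s) • V) i) * (-V i)
      = - (2 * ∑ i, (x i - (y + (t - s) • V) i) * V i) := by
    rw [Finset.mul_sum, ← Finset.sum_neg_distrib]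
    exact Finset.sum_congr rfl fun i _ => by ring
  rw [this]
  simp
  ring

lemma barr_reg {N : ℕ} (c ρ κ δ s : ℝ) (y V : Fin N → ℝ) : Reg0 (barr c ρ κ δ s y V) := by
  refine ⟨fun x t => (barr_deriv c ρ κ δ s y V x t).differentiableAt, fun t => ?_⟩
  unfold barr
  exact (contDiff_const.mul ((contDiff_const.sub (nn_contDiff _)).pow 2)).add contDiff_const

lemma barr_qOp {N : ℕ} {A : Fin N → Fin N → (Fin N → ℝ) → ℝ}
    {B : Fin N → (Fin N → ℝ) → ℝ} {a₀ CA CB : ℝ} (hQ : QC A B a₀ CA CB)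
    {c ρ κ δ s R : ℝ} {y V : Fin N → ℝ} {x : Fin N → ℝ} {t : ℝ} (hc : 0 ≤ c) (hρ : 0 < ρ)
    (hV : ∀ i, |V i| ≤ R)
    (hκ : κ = ((4 * (N * (ρ * R)) + 4 * (N * CA) + 4 * (N * (CB * ρ))) + 8 * a₀) ^ 2
      / (32 * a₀ * ρ ^ 2))
    (hx : nn (y + (t - s) • V) x ≤ ρ ^ 2) :
    qOp A B (barr c ρ κ δ s y V) x t ≤ -2 * δ := by
  unfold qOp
  rw [(barr_deriv c ρ κ δ s y V x t).deriv]
  unfold barr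
  set ξ := y + (t - s) • V with hξ
  set E := Real.exp (-κ * (t - s)) with hE
  have hE0 : 0 < E := Real.exp_pos _
  set q := ρ ^ 2 - nn ξ x with hq
  have hq0 : 0 ≤ q := by linarith
  simp_rw [pd2_bar, pd_bar]
  have e1 : ∑ i, ∑ j, A i j x * (-4 * (c * E) * (-2 * (x i - ξ i) * (x j - ξ j) +
      (ρ ^ 2 - nn ξ x) * (if i = j then 1 else 0)))
      = c * E * (8 * (∑ i, ∑ j, A i j x * (x i - ξ i) * (x j - ξ j)) - 4 * q * ∑ i, A i i x) := by
    have : ∑ i, A i i x = ∑ i, ∑ j, A i j x * (if i = j then 1 else 0) := by simp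
    rw [this, ← hq]
    simp only [Finset.mul_sum, mul_sub, ← Finset.sum_sub_distrib]
    refine Finset.sum_congr rfl fun i _ => Finset.sum_congr rfl fun j _ => ?_
    ring
  have e2 : ∑ i, B i x * (-4 * (c * E) * ((ρ ^ 2 - nn ξ x) * (x i - ξ i)))
      = c * E * (- 4 * q * ∑ i, B i x * (x i - ξ i)) := by
    rw [← hq]
    simp only [Finset.mul_sum]
    refine Finset.sum_congr rfl fun i _ => ?_
    ring
  rw [e1, e2]
  have hd : ∀ i, |x i - ξ i| ≤ ρ := abs_le_of_nn hρ.le hx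
  have b1 : ∑ i, (x i - ξ i) * V i ≤ N * (ρ * R) := (le_abs_self _).trans (sum_abs_le fun i => by
    rw [abs_mul]; exact mul_le_mul (hd i) (hV i) (abs_nonneg _) hρ.le)
  have b2 : ∑ i, A i i x ≤ N * CA := (le_abs_self _).trans (sum_abs_le fun i => hQ.bA i i x)
  have b3 : ∑ i, B i x * (x i - ξ i) ≤ N * (CB * ρ) := (le_abs_self _).trans
    (sum_abs_le fun i => by
      rw [abs_mul]; exact mul_le_mul (hQ.bB i x) (hd i) (abs_nonneg _) hQ.CB0)
  have b4 := hQ.ell x (fun i => x i - ξ i)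
  have b4' : a₀ * (ρ ^ 2 - q) ≤ ∑ i, ∑ j, A i j x * (x i - ξ i) * (x j - ξ j) := by
    refine le_trans (le_of_eq ?_) b4
    simp [hq, nn]
  set s1 := ∑ i, (x i - ξ i) * V i
  set s2 := ∑ i, A i i x
  set s3 := ∑ i, B i x * (x i - ξ i)
  set s4 := ∑ i, ∑ j, A i j x * (x i - ξ i) * (x j - ξ j)
  have key : 2 * q * (2 * s1) - κ * q ^ 2 - (8 * s4 - 4 * q * s2) - (-4 * q * s3) ≤ 0 := by
    apply barrier_arith (q := q) hQ.pos hρ hκ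
    have m1 := mul_le_mul_of_nonneg_left b1 hq0
    have m2 := mul_le_mul_of_nonneg_left b2 hq0
    have m3 := mul_le_mul_of_nonneg_left b3 hq0
    nlinarith
  have := mul_nonpos_of_nonneg_of_nonpos (mul_nonneg hc hE0.le) key
  nlinarith

/-- Propagation of positivity, in quantitative form. -/
lemma propagate {N : ℕ} {A : Fin N → Fin N → (Fin N → ℝ) → ℝ}
    {B : Fin N → (Fin N → ℝ) → ℝ} {a₀ CA CB : ℝ} (hQ : QC A B a₀ CA CB)
    {ρ R T ε : ℝ} (hρ : 0 < ρ) (hR : 0 ≤ R) (hT : 0 ≤ T) (hε : 0 < ε) :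
    ∃ δ : ℝ, 0 < δ ∧ ∀ z : (Fin N → ℝ) → ℝ → ℝ, RegSol z → ∀ (x₀ : Fin N → ℝ) (t₀ : ℝ),
      (∀ x t, ‖x - x₀‖ ≤ R + ρ → t₀ - T ≤ t → t ≤ t₀ → 0 ≤ z x t) →
      (∀ x t, ‖x - x₀‖ ≤ R + ρ → t₀ - T ≤ t → t ≤ t₀ → -δ ≤ qOp A B z x t) →
      z x₀ t₀ ≤ δ → ∀ y s, ‖y - x₀‖ ≤ R → t₀ - T ≤ s → s ≤ t₀ - 1 →
      ∃ x, ‖x - y‖ ≤ ρ ∧ z x s < ε := by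
  set κ := ((4 * (N * (ρ * R)) + 4 * (N * CA) + 4 * (N * (CB * ρ))) + 8 * a₀) ^ 2
      / (32 * a₀ * ρ ^ 2) with hκ
  have ha := hQ.pos
  have hκ0 : 0 ≤ κ := by positivity
  set c := ε / ρ ^ 4 with hc
  have hc0 : 0 < c := by positivity
  set δ := ε * Real.exp (-κ * T) / (2 * (1 + 2 * T)) with hδ
  have hδ0 : 0 < δ := by positivity
  have hδ1 : δ * (2 * (1 + 2 * T)) = ε * Real.exp (-κ * T) := by rw [hδ]; field_simp
  refine ⟨δ, hδ0, ?_⟩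
  intro z hz x₀ t₀ hpos hq hz0 y s hy hsT hs1
  by_contra hcon
  push Not at hcon
  have hts : 1 ≤ t₀ - s := by linarith
  set V : Fin N → ℝ := (t₀ - s)⁻¹ • (x₀ - y) with hVdef
  have hV : ∀ i, |V i| ≤ R := by
    intro i
    have h1 : |(x₀ - y) i| ≤ R := by
      rw [norm_sub_rev] at hy
      exact (norm_le_pi_norm (x₀ - y) i).trans hy
    simp only [hVdef, Pi.smul_apply, smul_eq_mul, abs_mul]
    have h2 : |(t₀ - s)⁻¹| ≤ 1 := by
      rw [abs_of_pos (by positivity)]; exact inv_le_one_of_one_le₀ hts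
    calc _ ≤ 1 * |(x₀ - y) i| := mul_le_mul_of_nonneg_right h2 (abs_nonneg _)
      _ ≤ R := by rw [one_mul]; exact h1
  set H := barr c ρ κ δ s y V with hH
  set D : Set ((Fin N → ℝ) × ℝ) := {p | nn (y + (p.2 - s) • V) p.1 ≤ ρ ^ 2 ∧ s ≤ p.2 ∧ p.2 ≤ t₀}
  have hctr : ∀ t, s ≤ t → t ≤ t₀ → ‖y + (t - s) • V - x₀‖ ≤ R := by
    intro t h1 h2
    have : y + (t - s) • V - x₀ = (1 - (t - s) * (t₀ - s)⁻¹) • (y - x₀) := by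
      ext i; simp [hVdef]; ring
    rw [this, norm_smul]
    have h3 : |1 - (t - s) * (t₀ - s)⁻¹| ≤ 1 := by
      have h4 : (t - s) * (t₀ - s)⁻¹ ≤ 1 := by
        rw [← div_eq_mul_inv, div_le_one (by linarith)]; linarith
      have h5 : 0 ≤ (t - s) * (t₀ - s)⁻¹ := mul_nonneg (by linarith) (by positivity)
      rw [abs_le]; constructor <;> linarith
    rw [Real.norm_eq_abs]
    calc _ ≤ 1 * ‖y - x₀‖ := mul_le_mul_of_nonneg_right h3 (norm_nonneg _)
      _ ≤ R := by rw [one_mul]; exact hy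
  have hwin : ∀ p ∈ D, ‖p.1 - x₀‖ ≤ R + ρ ∧ t₀ - T ≤ p.2 ∧ p.2 ≤ t₀ := by
    rintro ⟨x, t⟩ ⟨h1, h2, h3⟩
    refine ⟨?_, by simp only at h2 ⊢; linarith, h3⟩
    have h4 := norm_le_of_nn hρ.le h1
    calc ‖x - x₀‖ = ‖(x - (y + (t - s) • V)) + (y + (t - s) • V - x₀)‖ := by congr 1; abel
      _ ≤ _ := norm_add_le _ _
      _ ≤ R + ρ := by have := hctr t h2 h3; simp only at h4; linarith
  have cn : Continuous (fun p : (Fin N → ℝ) × ℝ => nn (y + (p.2 - s) • V) p.1) := by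
    unfold nn; fun_prop
  have hDc : IsCompact D := by
    apply Metric.isCompact_of_isClosed_isBounded
    · exact (isClosed_le cn continuous_const).inter
        ((isClosed_le continuous_const continuous_snd).inter
          (isClosed_le continuous_snd continuous_const))
    · refine (Metric.isBounded_closedBall (x := (x₀, t₀)) (r := max (R + ρ) T)).subset ?_
      intro p hp
      obtain ⟨h1, h2, h3⟩ := hwin p hp
      rw [Metric.mem_closedBall, Prod.dist_eq, dist_eq_norm, Real.dist_eq]
      apply max_le_max h1
      rw [abs_le]; constructor <;> linarith
  have hDx0 : (x₀, t₀) ∈ D := by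
    refine ⟨?_, by simp only; linarith, le_refl _⟩
    have : y + (t₀ - s) • V = x₀ := by
      ext i
      have : t₀ - s ≠ 0 := by linarith
      simp [hVdef]; field_simp; ring
    simp only [this]
    simp [nn]; positivity
  have hHc : Continuous (fun p : (Fin N → ℝ) × ℝ => H p.1 p.2) := by
    simp only [hH, barr]
    fun_prop
  obtain ⟨⟨x, t⟩, hxt, hmin⟩ := hDc.exists_isMinOn ⟨_, hDx0⟩ (hz.1.sub hHc).continuousOn
  have hmin' : ∀ x' t', (x', t') ∈ D → z x t - H x t ≤ z x' t' - H x' t' := fun x' t' h => hmin h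
  rcases le_or_gt 0 (z x t - H x t) with hge | hlt
  · have h1 := hmin' x₀ t₀ hDx0
    have h2 : H x₀ t₀ = ε * Real.exp (-κ * (t₀ - s)) - 2 * δ * (t₀ - s) := by
      have : y + (t₀ - s) • V = x₀ := by
        ext i
        have : t₀ - s ≠ 0 := by linarith
        simp [hVdef]; field_simp; ring
      simp only [hH, barr, this, hc]
      simp [nn]
      field_simp
      ring
    have h3 : Real.exp (-κ * T) ≤ Real.exp (-κ * (t₀ - s)) := by
      apply Real.exp_le_exp.2
      nlinarith
    have h4 := mul_le_mul_of_nonneg_left h3 hε.le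
    nlinarith
  · obtain ⟨k1, k2, k3⟩ := hxt
    simp only at k1 k2 k3
    have hts' : s < t := by
      rcases k2.lt_or_eq with h | h
      · exact h
      · exfalso
        subst h
        simp only [sub_self, zero_smul, add_zero] at k1
        have h1 := hcon x (norm_le_of_nn hρ.le k1)
        have h2 : H x s ≤ ε := by
          simp only [hH, barr, sub_self, zero_smul, add_zero, mul_zero, Real.exp_zero, mul_one,
            neg_zero]
          have h3 : (ρ ^ 2 - nn y x) ^ 2 ≤ (ρ ^ 2) ^ 2 :=
            pow_le_pow_left₀ (by linarith) (by linarith [nn_nonneg y x]) 2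
          calc _ ≤ c * (ρ ^ 2) ^ 2 := mul_le_mul_of_nonneg_left h3 hc0.le
            _ = ε := by rw [hc]; field_simp
        linarith
    have hlat : nn (y + (t - s) • V) x < ρ ^ 2 := by
      rcases k1.lt_or_eq with h | h
      · exact h
      · exfalso
        obtain ⟨w1, w2, w3⟩ := hwin (x, t) ⟨k1, k2, k3⟩
        have h1 := hpos x t w1 w2 w3
        have h2 : H x t ≤ 0 := by
          simp only [hH, barr, h, sub_self]
          have : 0 ≤ 2 * δ * (t - s) := mul_nonneg (by linarith) (by linarith)
          simp; linarith
        linarith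
    have hz0' : Reg0 z := ⟨hz.2.1, hz.2.2⟩
    have hHr : Reg0 H := barr_reg c ρ κ δ s y V
    have hmax := qOp_nonneg_of_max hQ (hHr.sub hz0') x t
      (by
        have : Continuous (fun x' => nn (y + (t - s) • V) x') := (nn_contDiff _).continuous
        filter_upwards [this.continuousAt.eventually_lt_const hlat] with x' hx'
        have := hmin' x' t ⟨hx'.le, k2, k3⟩
        linarith)
      (by
        have c1 : Continuous (fun t' => nn (y + (t' - s) • V) x) := by unfold nn; fun_prop
        filter_upwards [self_mem_nhdsWithin,
          nhdsWithin_le_nhds (c1.continuousAt.eventually_lt_const hlat),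
          nhdsWithin_le_nhds (eventually_gt_nhds hts')] with t' h1 h2 h3
        have h1' : t' < t := h1
        have := hmin' x t' ⟨h2.le, le_of_lt h3, by simp only; linarith⟩
        linarith)
    rw [qOp_sub A B hHr hz0'] at hmax
    have h1 : qOp A B H x t ≤ -2 * δ := barr_qOp hQ hc0.le hρ hV hκ k1
    obtain ⟨w1, w2, w3⟩ := hwin (x, t) ⟨k1, k2, k3⟩
    have h2 := hq x t w1 w2 w3
    linarith

/-- Maximum principle on the whole space for `∂ₜ - M + lam`. -/
lemma max_principle {N : ℕ} {A : Fin N → Fin N → (Fin N → ℝ) → ℝ}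
    {B : Fin N → (Fin N → ℝ) → ℝ} {a₀ CA CB : ℝ} (hQ : QC A B a₀ CA CB)
    {w : (Fin N → ℝ) → ℝ → ℝ} (hw : RegSol w) {K lam G : ℝ} (hK : ∀ x t, |w x t| ≤ K)
    (hlam : 0 < lam) (h : ∀ x t, qOp A B w x t + lam * w x t ≤ G) (x : Fin N → ℝ) (t : ℝ) :
    lam * w x t ≤ G := by
  set S := ⨆ p : (Fin N → ℝ) × ℝ, w p.1 p.2 with hS
  have hbd : BddAbove (Set.range fun p : (Fin N → ℝ) × ℝ => w p.1 p.2) :=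
    ⟨K, by rintro _ ⟨p, rfl⟩; exact (le_abs_self _).trans (hK _ _)⟩
  have hle : ∀ x t, w x t ≤ S := fun x t => le_ciSup hbd (x, t)
  set C := 2 + 2 * (N * CA) + 2 * (N * CB) + lam with hC
  have hCA := hQ.CA0
  have hCB := hQ.CB0
  have hC0 : 0 < C := by positivity
  have key : ∀ θ > 0, lam * S ≤ G + C * θ := by
    intro θ hθ
    obtain ⟨⟨x₀, t₀⟩, h0⟩ := exists_lt_of_lt_ciSup (show S - θ < ⨆ p : (Fin N → ℝ) × ℝ, w p.1 p.2 by
      rw [← hS]; linarith)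
    simp only at h0
    set p : (Fin N → ℝ) → ℝ → ℝ := fun x t => θ * nn x₀ x + θ * (t - t₀) ^ 2 with hp
    have hpc : Continuous (fun q : (Fin N → ℝ) × ℝ => p q.1 q.2) := by
      simp only [hp, nn]; fun_prop
    obtain ⟨⟨x1, t1⟩, h1, hmax⟩ := (isCompact_closedBall (x₀, t₀) 1).exists_isMaxOn
      ⟨_, Metric.mem_closedBall_self zero_le_one⟩ (hw.1.sub hpc).continuousOn
    have hmax' : ∀ x' t', ‖x' - x₀‖ ≤ 1 → |t' - t₀| ≤ 1 →
        w x' t' - p x' t' ≤ w x1 t1 - p x1 t1 := by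
      intro x' t' e1 e2
      refine hmax (a := (x', t')) ?_
      rw [Metric.mem_closedBall, Prod.dist_eq, dist_eq_norm, Real.dist_eq]
      exact max_le e1 e2
    have hp0 : p x₀ t₀ = 0 := by simp [hp, nn]
    have hv := hmax' x₀ t₀ (by simp) (by simp)
    rw [hp0] at hv
    have hp1 : p x1 t1 < θ := by have := hle x1 t1; linarith
    have hnn0 := nn_nonneg x₀ x1
    have hlt1 : nn x₀ x1 < 1 := by
      simp only [hp] at hp1
      have : 0 ≤ θ * (t1 - t₀) ^ 2 := by positivity
      by_contra hc
      push Not at hc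
      have := mul_le_mul_of_nonneg_left hc hθ.le
      linarith
    have hlt2 : (t1 - t₀) ^ 2 < 1 := by
      simp only [hp] at hp1
      have : 0 ≤ θ * nn x₀ x1 := by positivity
      by_contra hc
      push Not at hc
      have := mul_le_mul_of_nonneg_left hc hθ.le
      linarith
    have hlt2' : |t1 - t₀| < 1 := by
      rw [← sq_lt_one_iff_abs_lt_one]; exact hlt2
    have hpr : Reg0 p := by
      refine ⟨fun x => ?_, fun t => ?_⟩
      · simp only [hp]; fun_prop
      · exact (contDiff_const.mul (nn_contDiff x₀)).add contDiff_const
    have hwr : Reg0 w := ⟨hw.2.1, hw.2.2⟩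
    have hm := qOp_nonneg_of_max hQ (hwr.sub hpr) x1 t1
      (by
        have : Continuous (fun x' => nn x₀ x') := (nn_contDiff _).continuous
        filter_upwards [this.continuousAt.eventually_lt_const hlt1] with x' hx'
        exact hmax' x' t1 (norm_le_of_nn zero_le_one (by linarith)) hlt2'.le)
      (by
        have : Continuous (fun t' : ℝ => |t' - t₀|) := by fun_prop
        refine nhdsWithin_le_nhds ?_
        filter_upwards [this.continuousAt.eventually_lt_const hlt2'] with t' ht'
        exact hmax' x1 t' (norm_le_of_nn zero_le_one (by linarith)) ht'.le)
    rw [qOp_sub A B hwr hpr] at hm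
    have hq : -(2 + 2 * (N * CA) + 2 * (N * CB)) * θ ≤ qOp A B p x1 t1 := by
      unfold qOp
      have e0 : HasDerivAt (fun s => p x1 s) (θ * (2 * (t1 - t₀))) t1 := by
        have := ((((hasDerivAt_id t1).sub_const t₀).pow 2).const_mul θ).const_add (θ * nn x₀ x1)
        refine this.congr_deriv ?_
        simp
      rw [e0.deriv]
      simp only [hp]
      simp_rw [fun i j => (pd2_nn x₀ θ (θ * (t1 - t₀) ^ 2) i j x1).1,
        fun j => (pd2_nn x₀ θ (θ * (t1 - t₀) ^ 2) j j x1).2]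
      have s1 : ∑ i, ∑ j, A i j x1 * (2 * θ * (if i = j then 1 else 0)) = 2 * θ * ∑ i, A i i x1 := by
        simp [Finset.mul_sum]
        exact Finset.sum_congr rfl fun i _ => by ring
      have s2 : ∑ i, B i x1 * (2 * θ * (x1 i - x₀ i)) = 2 * θ * ∑ i, B i x1 * (x1 i - x₀ i) := by
        rw [Finset.mul_sum]
        exact Finset.sum_congr rfl fun i _ => by ring
      rw [s1, s2]
      have b2 : ∑ i, A i i x1 ≤ N * CA := (le_abs_self _).trans (sum_abs_le fun i => hQ.bA i i x1)
      have hd : ∀ i, |x1 i - x₀ i| ≤ 1 := abs_le_of_nn zero_le_one (by linarith)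
      have b3 : ∑ i, B i x1 * (x1 i - x₀ i) ≤ N * (CB * 1) := (le_abs_self _).trans
        (sum_abs_le fun i => by
          rw [abs_mul]; exact mul_le_mul (hQ.bB i x1) (hd i) (abs_nonneg _) hQ.CB0)
      have b1 := (abs_lt.1 hlt2').1
      have m1 := mul_le_mul_of_nonneg_left b2 hθ.le
      have m2 := mul_le_mul_of_nonneg_left b3 hθ.le
      have m3 := mul_lt_mul_of_pos_left b1 hθ
      nlinarith
    have h2 := h x1 t1
    have hp1' : 0 ≤ p x1 t1 := by simp only [hp]; positivity
    have h3 : S - θ ≤ w x1 t1 := by linarith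
    have h4 := mul_le_mul_of_nonneg_left h3 hlam.le
    have h5 : C * θ = (2 + 2 * (N * CA) + 2 * (N * CB)) * θ + lam * θ := by rw [hC]; ring
    linarith
  have hfin : lam * S ≤ G := by
    refine le_of_forall_pos_le_add fun ε hε => ?_
    have := key (ε / C) (by positivity)
    rwa [mul_div_cancel₀ _ hC0.ne'] at this
  exact (mul_le_mul_of_nonneg_left (hle x t) hlam.le).trans hfin


lemma localMax_space {N : ℕ} {φ : (Fin N → ℝ) → ℝ} (hφ : ContDiff ℝ 2 φ) {x : Fin N → ℝ}
    (hx : ∀ᶠ y in 𝓝 x, φ y ≤ φ x) : (∀ i, pd i φ x = 0) ∧ ∀ ξ, hess φ x ξ ≤ 0 := by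
  constructor
  · intro i
    have : IsLocalMax φ x := hx
    simp [pd, this.fderiv_eq_zero]
  · intro ξ
    have e1 := line_deriv (hφ.differentiable (by norm_num)) x ξ
    have e2 := line_deriv2 hφ x ξ 0
    simp only [zero_smul, add_zero] at e2
    refine second_diff_le e1 e2 ?_
    have c1 : Tendsto (fun s : ℝ => x + s • ξ) (𝓝 0) (𝓝 x) := by
      have : Continuous (fun s : ℝ => x + s • ξ) := by fun_prop
      simpa using this.tendsto 0
    have c2 : Tendsto (fun s : ℝ => x + (-s) • ξ) (𝓝 0) (𝓝 x) := by
      have : Continuous (fun s : ℝ => x + (-s) • ξ) := by fun_prop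
      simpa using this.tendsto 0
    filter_upwards [c1.eventually hx, c2.eventually hx] with s k1 k2
    simp only [zero_smul, add_zero]
    linarith

lemma hess_sub {N : ℕ} {φ ψ : (Fin N → ℝ) → ℝ} (h1 : ContDiff ℝ 2 φ) (h2 : ContDiff ℝ 2 ψ)
    (x ξ : Fin N → ℝ) : hess (fun y => φ y - ψ y) x ξ = hess φ x ξ - hess ψ x ξ := by
  unfold hess
  simp_rw [pd2_sub h1 h2, mul_sub, Finset.sum_sub_distrib]

lemma hess_nn {N : ℕ} (a : Fin N → ℝ) (α β : ℝ) (x ξ : Fin N → ℝ) :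
    hess (fun y => α * nn a y + β) x ξ = 2 * α * ∑ i, ξ i ^ 2 := by
  unfold hess
  simp_rw [fun i j => (pd2_nn a α β i j x).1]
  simp [Finset.mul_sum]
  exact Finset.sum_congr rfl fun i _ => by ring

/-- Space touching by a quadratic from above. -/
lemma touch_quad {N : ℕ} {φ : (Fin N → ℝ) → ℝ} (hφ : ContDiff ℝ 2 φ) {x a b : Fin N → ℝ} {α β : ℝ}
    (hx : ∀ᶠ y in 𝓝 x, φ y - (α * nn a y + 0) - (β * nn b y + 0)
      ≤ φ x - (α * nn a x + 0) - (β * nn b x + 0)) :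
    (∀ i, pd i φ x = 2 * α * (x i - a i) + 2 * β * (x i - b i)) ∧
    ∀ ξ, hess φ x ξ ≤ (2 * α + 2 * β) * ∑ i, ξ i ^ 2 := by
  have ca : ∀ (α : ℝ) (a : Fin N → ℝ), ContDiff ℝ 2 (fun y => α * nn a y + 0) := fun α a =>
    (contDiff_const.mul (nn_contDiff a)).add contDiff_const
  have h12 : (1:WithTop ℕ∞) ≤ 2 := by norm_num
  obtain ⟨h1, h2⟩ := localMax_space ((hφ.sub (ca α a)).sub (ca β b)) hx
  constructor
  · intro i
    have h := h1 i
    rw [pd_sub ((hφ.sub (ca α a)).of_le h12) ((ca β b).of_le h12),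
      pd_sub (hφ.of_le h12) ((ca α a).of_le h12), (pd2_nn a α 0 i i x).2,
      (pd2_nn b β 0 i i x).2] at h
    linarith
  · intro ξ
    have h := h2 ξ
    rw [hess_sub (hφ.sub (ca α a)) (ca β b), hess_sub hφ (ca α a), hess_nn, hess_nn] at h
    linarith

lemma quartic_tangent {p ρ : ℝ} (hp : 0 < p) (hρ : 0 ≤ ρ) :
    √(√ρ) ≤ p + (ρ - p ^ 4) / (4 * p ^ 3) := by
  set q := √(√ρ) with hq
  have hq0 : 0 ≤ q := Real.sqrt_nonneg _
  have hq4 : q ^ 4 = ρ := by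
    have h1 : q ^ 2 = √ρ := Real.sq_sqrt (Real.sqrt_nonneg _)
    have h2 : (√ρ) ^ 2 = ρ := Real.sq_sqrt hρ
    calc q ^ 4 = (q ^ 2) ^ 2 := by ring
      _ = ρ := by rw [h1, h2]
  rw [← hq4]
  have h3 : 0 < 4 * p ^ 3 := by positivity
  rw [← sub_le_iff_le_add', le_div_iff₀ h3]
  nlinarith [sq_nonneg (q - p), sq_nonneg (q + p), mul_nonneg (sq_nonneg (q - p)) (sq_nonneg (q + p)),
    mul_nonneg (sq_nonneg (q - p)) (sq_nonneg p), mul_nonneg (sq_nonneg (q - p)) (sq_nonneg q)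
    , mul_nonneg (sq_nonneg (q - p)) (mul_nonneg hp.le hq0)]

lemma sqrt_sym {s : ℝ} (h1 : -(1/2) < s) (h2 : s < 1/2) :
    √(1 + 2 * s) + √(1 - 2 * s) - 2 ≤ - s ^ 2 := by
  set a := √(1 + 2 * s)
  set b := √(1 - 2 * s)
  have ha : a ^ 2 = 1 + 2 * s := Real.sq_sqrt (by linarith)
  have hb : b ^ 2 = 1 - 2 * s := Real.sq_sqrt (by linarith)
  have ha0 : 0 ≤ a := Real.sqrt_nonneg _
  have hb0 : 0 ≤ b := Real.sqrt_nonneg _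
  have hab : a * b ≤ 1 - 2 * s ^ 2 := by
    have h3 : (a * b) ^ 2 = 1 - 4 * s ^ 2 := by rw [mul_pow, ha, hb]; ring
    refine abs_le_of_sq_le_sq' ?_ (by nlinarith) |>.2
    rw [h3]; nlinarith [sq_nonneg (s ^ 2)]
  have h4 : a + b ≤ 2 - s ^ 2 := by
    refine abs_le_of_sq_le_sq' ?_ (by nlinarith) |>.2
    nlinarith [sq_nonneg (s ^ 2)]
  linarith

lemma nn_comm {N : ℕ} (a b : Fin N → ℝ) : nn a b = nn b a := by
  unfold nn; exact Finset.sum_congr rfl fun i _ => by ring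

lemma nn_sym_diff {N : ℕ} (a x ξ : Fin N → ℝ) (s : ℝ) :
    nn a (x + s • ξ) + nn a (x + (-s) • ξ) - 2 * nn a x = 2 * s ^ 2 * ∑ i, ξ i ^ 2 := by
  unfold nn
  simp only [Finset.mul_sum]
  rw [← Finset.sum_add_distrib, ← Finset.sum_sub_distrib]
  refine Finset.sum_congr rfl fun i _ => ?_
  simp
  ring

lemma form_le {N : ℕ} {M : Fin N → Fin N → ℝ} {μ : ℝ} (h : ∀ i j, |M i j| ≤ μ) (ξ : Fin N → ℝ) :
    |∑ i, ∑ j, M i j * ξ i * ξ j| ≤ N * μ * ∑ i, ξ i ^ 2 := by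
  have h1 : |∑ i, ∑ j, M i j * ξ i * ξ j| ≤ ∑ i, ∑ j, μ * ((ξ i ^ 2 + ξ j ^ 2) / 2) := by
    refine (Finset.abs_sum_le_sum_abs _ _).trans (Finset.sum_le_sum fun i _ => ?_)
    refine (Finset.abs_sum_le_sum_abs _ _).trans (Finset.sum_le_sum fun j _ => ?_)
    rw [mul_assoc, abs_mul]
    refine mul_le_mul (h i j) ?_ (abs_nonneg _) ((abs_nonneg _).trans (h i j))
    rw [abs_le]; constructor <;> nlinarith [sq_nonneg (ξ i - ξ j), sq_nonneg (ξ i + ξ j)]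
  refine h1.trans (le_of_eq ?_)
  simp_rw [← Finset.mul_sum, ← Finset.sum_div, Finset.sum_add_distrib, Finset.sum_const]
  simp only [Finset.card_univ, Fintype.card_fin, nsmul_eq_mul]
  rw [← Finset.mul_sum]
  ring

/-- Trace estimate in the doubling argument. -/
lemma trace_doubling {N : ℕ} {A₁ A₂ X Y : Fin N → Fin N → ℝ} {a₀ CA μ α p L : ℝ} {d : Fin N → ℝ}
    (ha : 0 < a₀) (hs1 : ∀ i j, A₁ i j = A₁ j i) (hs2 : ∀ i j, A₂ i j = A₂ j i)
    (hell : ∀ ξ : Fin N → ℝ, a₀ * ∑ i, ξ i ^ 2 ≤ ∑ i, ∑ j, A₁ i j * ξ i * ξ j)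
    (hCA : ∀ i j, |A₁ i j| ≤ CA) (hμ : ∀ i j, |A₂ i j - A₁ i j| ≤ μ) (hμ0 : 0 ≤ μ)
    (hμ1 : N * μ ≤ a₀ / 2) (hp : 0 < p) (hd : ∑ i, d i ^ 2 = p ^ 4) (hα : 0 ≤ α)
    (h1 : ∀ ξ : Fin N → ℝ, ∑ i, ∑ j, ξ i * ξ j * X i j - ∑ i, ∑ j, ξ i * ξ j * Y i j
      ≤ 2 * ∑ i, ξ i ^ 2)
    (h2 : ∀ ξ : Fin N → ℝ, ∑ i, ∑ j, ξ i * ξ j * X i j ≤ (2 * α + 2) * ∑ i, ξ i ^ 2)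
    (h3 : ∀ ξ : Fin N → ℝ, -∑ i, ∑ j, ξ i * ξ j * Y i j ≤ 2 * α * ∑ i, ξ i ^ 2)
    (h4 : ∑ i, ∑ j, d i * d j * X i j - ∑ i, ∑ j, d i * d j * Y i j ≤ -L * p + 2 * p ^ 4) :
    ∑ i, ∑ j, A₁ i j * X i j - ∑ i, ∑ j, A₂ i j * Y i j
      ≤ 2 * (N * CA) + N * μ * N * (2 * α + 2) + 2 * α * (N * (μ + N * μ))
        + a₀ / (2 * p ^ 4) * (-L * p + 2 * p ^ 4) := by
  set ω := N * μ with hω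
  have hω0 : 0 ≤ ω := by positivity
  set β := a₀ / (2 * p ^ 4) with hβ
  have hβ0 : 0 ≤ β := by positivity
  have hβp : β * p ^ 4 = a₀ / 2 := by rw [hβ]; field_simp
  set δ : Fin N → Fin N → ℝ := fun i j => if i = j then 1 else 0 with hδ
  have hδs : ∀ i j, δ i j = δ j i := fun i j => by simp [hδ, eq_comm]
  have hδq : ∀ ξ : Fin N → ℝ, ∑ i, ∑ j, δ i j * ξ i * ξ j = ∑ i, ξ i ^ 2 := by
    intro ξ; simp [hδ, pow_two]
  have hδq' : ∀ ξ : Fin N → ℝ, ∑ i, ∑ j, ξ i * ξ j * δ i j = ∑ i, ξ i ^ 2 := by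
    intro ξ; simp [hδ, pow_two]
  have hδt : ∀ M : Fin N → Fin N → ℝ, ∑ i, ∑ j, M i j * δ i j = ∑ i, M i i := by
    intro M; simp [hδ]
  have hδd : ∀ i, δ i i = 1 := by intro i; simp [hδ]
  -- first piece
  have t1 := trace_nonneg (fun i j => A₁ i j - ω * δ i j - β * (d i * d j))
    (fun i j => 2 * δ i j - X i j + Y i j) (fun i j => by rw [hs1, hδs]; ring)
    (fun ξ => by
      have e : ∑ i, ∑ j, (A₁ i j - ω * δ i j - β * (d i * d j)) * ξ i * ξ j
          = ∑ i, ∑ j, A₁ i j * ξ i * ξ j - ω * ∑ i, ξ i ^ 2 - β * (∑ i, d i * ξ i) ^ 2 := by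
        rw [← hδq ξ, pow_two, Finset.sum_mul_sum]
        simp only [Finset.mul_sum, ← Finset.sum_sub_distrib]
        refine Finset.sum_congr rfl fun i _ => Finset.sum_congr rfl fun j _ => ?_
        ring
      rw [e]
      have cs := Finset.sum_mul_sq_le_sq_mul_sq Finset.univ d ξ
      rw [hd] at cs
      have := mul_le_mul_of_nonneg_left cs hβ0
      have hE := hell ξ
      have hn : 0 ≤ ∑ i, ξ i ^ 2 := Finset.sum_nonneg fun _ _ => sq_nonneg _
      have h5 : β * (p ^ 4 * ∑ i, ξ i ^ 2) = a₀ / 2 * ∑ i, ξ i ^ 2 := by rw [← mul_assoc, hβp]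
      have h6 := mul_le_mul_of_nonneg_right hμ1 hn
      linarith)
    (fun ξ => by
      have e : ∑ i, ∑ j, ξ i * ξ j * (2 * δ i j - X i j + Y i j)
          = 2 * ∑ i, ξ i ^ 2 - ∑ i, ∑ j, ξ i * ξ j * X i j + ∑ i, ∑ j, ξ i * ξ j * Y i j := by
        rw [← hδq' ξ]
        simp only [Finset.mul_sum, ← Finset.sum_sub_distrib, ← Finset.sum_add_distrib]
        refine Finset.sum_congr rfl fun i _ => Finset.sum_congr rfl fun j _ => ?_
        ring
      rw [e]
      linarith [h1 ξ])
  have t2 := trace_nonneg (fun i j => ω * δ i j)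
    (fun i j => (2 * α + 2) * δ i j - X i j) (fun i j => by rw [hδs])
    (fun ξ => by
      have e : ∑ i, ∑ j, ω * δ i j * ξ i * ξ j = ω * ∑ i, ξ i ^ 2 := by
        rw [← hδq ξ]
        simp only [Finset.mul_sum]
        refine Finset.sum_congr rfl fun i _ => Finset.sum_congr rfl fun j _ => ?_
        ring
      rw [e]
      exact mul_nonneg hω0 (Finset.sum_nonneg fun _ _ => sq_nonneg _))
    (fun ξ => by
      have e : ∑ i, ∑ j, ξ i * ξ j * ((2 * α + 2) * δ i j - X i j)
          = (2 * α + 2) * ∑ i, ξ i ^ 2 - ∑ i, ∑ j, ξ i * ξ j * X i j := by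
        rw [← hδq' ξ]
        simp only [Finset.mul_sum, ← Finset.sum_sub_distrib]
        refine Finset.sum_congr rfl fun i _ => Finset.sum_congr rfl fun j _ => ?_
        ring
      rw [e]
      linarith [h2 ξ])
  have t3 := trace_nonneg (fun i j => A₂ i j - A₁ i j + ω * δ i j)
    (fun i j => 2 * α * δ i j + Y i j) (fun i j => by rw [hs1, hs2, hδs])
    (fun ξ => by
      have e : ∑ i, ∑ j, (A₂ i j - A₁ i j + ω * δ i j) * ξ i * ξ j
          = ∑ i, ∑ j, (A₂ i j - A₁ i j) * ξ i * ξ j + ω * ∑ i, ξ i ^ 2 := by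
        rw [← hδq ξ]
        simp only [Finset.mul_sum, ← Finset.sum_add_distrib]
        refine Finset.sum_congr rfl fun i _ => Finset.sum_congr rfl fun j _ => ?_
        ring
      rw [e]
      have := (abs_le.1 (form_le hμ ξ)).1
      linarith)
    (fun ξ => by
      have e : ∑ i, ∑ j, ξ i * ξ j * (2 * α * δ i j + Y i j)
          = 2 * α * ∑ i, ξ i ^ 2 + ∑ i, ∑ j, ξ i * ξ j * Y i j := by
        rw [← hδq' ξ]
        simp only [Finset.mul_sum, ← Finset.sum_add_distrib]
        refine Finset.sum_congr rfl fun i _ => Finset.sum_congr rfl fun j _ => ?_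
        ring
      rw [e]
      linarith [h3 ξ])
  have t4 := mul_le_mul_of_nonneg_left h4 hβ0
  -- trace bounds
  have b1 : ∑ i, (A₁ i i - ω * δ i i - β * (d i * d i)) ≤ N * CA := by
    have : ∑ i : Fin N, (A₁ i i - ω * δ i i - β * (d i * d i)) ≤ ∑ _i : Fin N, CA := by
      refine Finset.sum_le_sum fun i _ => ?_
      rw [hδd]
      have := (abs_le.1 (hCA i i)).2
      have h7 : 0 ≤ β * (d i * d i) := mul_nonneg hβ0 (mul_self_nonneg _)
      linarith
    simpa using this
  have b3 : ∑ i, (A₂ i i - A₁ i i + ω * δ i i) ≤ N * (μ + ω) := by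
    have : ∑ i : Fin N, (A₂ i i - A₁ i i + ω * δ i i) ≤ ∑ _i : Fin N, (μ + ω) := by
      refine Finset.sum_le_sum fun i _ => ?_
      rw [hδd]
      have := (abs_le.1 (hμ i i)).2
      linarith
    simpa [mul_add] using this
  have b2 : ∑ i, ω * δ i i = ω * N := by simp [hδd, mul_comm]
  have b3' := mul_le_mul_of_nonneg_left b3 (by positivity : 0 ≤ 2 * α)
  -- combine
  have hid : ∑ i, ∑ j, A₁ i j * X i j - ∑ i, ∑ j, A₂ i j * Y i j
      = 2 * (∑ i, (A₁ i i - ω * δ i i - β * (d i * d i)))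
        + (2 * α + 2) * (∑ i, ω * δ i i) + 2 * α * (∑ i, (A₂ i i - A₁ i i + ω * δ i i))
        + β * (∑ i, ∑ j, d i * d j * X i j - ∑ i, ∑ j, d i * d j * Y i j)
        - (∑ i, ∑ j, (A₁ i j - ω * δ i j - β * (d i * d j)) * (2 * δ i j - X i j + Y i j))
        - (∑ i, ∑ j, (ω * δ i j) * ((2 * α + 2) * δ i j - X i j))
        - ∑ i, ∑ j, (A₂ i j - A₁ i j + ω * δ i j) * (2 * α * δ i j + Y i j) := by
    rw [← hδt (fun i j => A₁ i j - ω * δ i j - β * (d i * d j)), ← hδt (fun i j => ω * δ i j),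
      ← hδt (fun i j => A₂ i j - A₁ i j + ω * δ i j)]
    simp only [Finset.mul_sum, ← Finset.sum_sub_distrib, ← Finset.sum_add_distrib]
    refine Finset.sum_congr rfl fun i _ => Finset.sum_congr rfl fun j _ => ?_
    ring
  rw [hid, b2]
  nlinarith


/-- Double second difference along a pair of directions. -/
lemma pair_hess {N : ℕ} {φ : (Fin N → ℝ) → ℝ} (hφ : ContDiff ℝ 2 φ) (x y ξ ζ : Fin N → ℝ) {c : ℝ}
    (h : ∀ᶠ s in 𝓝 (0:ℝ), (φ (x + s • ξ) - φ (y + s • ζ)) + (φ (x + (-s) • ξ) - φ (y + (-s) • ζ))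
      - 2 * (φ x - φ y) ≤ c * s ^ 2) : hess φ x ξ - hess φ y ζ ≤ c := by
  have hd := hφ.differentiable (by norm_num)
  have e1 := fun s => (line_deriv hd x ξ s).sub (line_deriv hd y ζ s)
  have e2 := (line_deriv2 hφ x ξ 0).sub (line_deriv2 hφ y ζ 0)
  simp only [zero_smul, add_zero] at e2
  refine second_diff_le e1 e2 ?_
  filter_upwards [h] with s hs
  simpa using hs

lemma holder_core {N : ℕ} {A : Fin N → Fin N → (Fin N → ℝ) → ℝ} {B : Fin N → (Fin N → ℝ) → ℝ}
    {a₀ CA CB : ℝ} (hQ : QC A B a₀ CA CB) {v : (Fin N → ℝ) → ℝ → ℝ} (hv : RegSol v) {G : ℝ}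
    (hG : ∀ x t, |qOp A B v x t| ≤ G) {x0 x1 y1 : Fin N → ℝ} {t0 t1 L p μ : ℝ} (hL : 0 < L)
    (hp : 0 < p) (hp4 : nn y1 x1 = p ^ 4) (hx : ∀ i, |x1 i - x0 i| ≤ 1) (ht : |t1 - t0| ≤ 1)
    (hμ : ∀ i j, |A i j y1 - A i j x1| ≤ μ) (hμ0 : 0 ≤ μ) (hμ1 : N * μ ≤ a₀ / 2)
    (hmax : ∀ᶠ q : (Fin N → ℝ) × (Fin N → ℝ) × ℝ in 𝓝 (x1, y1, t1),
      v q.1 q.2.2 - v q.2.1 q.2.2 - L * √(√(nn q.2.1 q.1)) - nn x0 q.1 - (q.2.2 - t0) ^ 2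
      ≤ v x1 t1 - v y1 t1 - L * √(√(nn y1 x1)) - nn x0 x1 - (t1 - t0) ^ 2) :
    2 * (L / (4 * p ^ 3)) * a₀ ≤ 2 + 2 * G + 2 * (N * CA) + 2 * (N * μ * N) + a₀ + 2 * (N * CB)
      + L / (4 * p ^ 3) * (2 * (N * μ * N) + 2 * (N * (μ + N * μ)) + 4 * (N * CB) * p ^ 2) := by
  set α := L / (4 * p ^ 3) with hα
  have hα0 : 0 < α := by positivity
  have hLα : L = 4 * α * p ^ 3 := by rw [hα]; field_simp
  have hs4 : √(√(p ^ 4)) = p := by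
    rw [show p ^ 4 = (p ^ 2) ^ 2 by ring, Real.sqrt_sq (by positivity), Real.sqrt_sq hp.le]
  rw [hp4, hs4] at hmax
  set d : Fin N → ℝ := fun i => x1 i - y1 i with hd
  have hdd : ∑ i, d i ^ 2 = p ^ 4 := hp4
  have hdi : ∀ i, |d i| ≤ p ^ 2 := by
    intro i
    refine abs_le_of_sq_le_sq ?_ (by positivity)
    calc d i ^ 2 ≤ ∑ i, d i ^ 2 := Finset.single_le_sum (f := fun i => d i ^ 2)
          (fun _ _ => sq_nonneg _) (Finset.mem_univ i)
      _ = (p ^ 2) ^ 2 := by rw [hdd]; ring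
  have hc2 := hv.2.2 t1
  have hc1 : ContDiff ℝ 1 (fun y => v y t1) := hc2.of_le (by norm_num)
  -- time
  have htime : deriv (fun s => v x1 s) t1 - deriv (fun s => v y1 s) t1 = 2 * (t1 - t0) := by
    have c1 : Tendsto (fun s : ℝ => (x1, y1, s)) (𝓝 t1) (𝓝 (x1, y1, t1)) := by
      have : Continuous (fun s : ℝ => (x1, y1, s)) := by fun_prop
      exact this.tendsto t1
    have hm : IsLocalMax (fun s => v x1 s - v y1 s - (s - t0) ^ 2) t1 := by
      filter_upwards [c1.eventually hmax] with s hs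
      simp only [hp4, hs4] at hs
      linarith
    have hD : HasDerivAt (fun s => v x1 s - v y1 s - (s - t0) ^ 2)
        (deriv (fun s => v x1 s) t1 - deriv (fun s => v y1 s) t1 - 2 * (t1 - t0)) t1 := by
      have k := ((hasDerivAt_id t1).sub_const t0).pow 2
      simp at k
      exact ((hv.2.1 x1 t1).hasDerivAt.sub (hv.2.1 y1 t1).hasDerivAt).sub k
    have := hm.hasDerivAt_eq_zero hD
    linarith
  -- touching at x1
  obtain ⟨gx, h2⟩ := touch_quad (x := x1) (a := y1) (b := x0) (α := α) (β := 1) hc2 (by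
    have c1 : Tendsto (fun y : Fin N → ℝ => (y, y1, t1)) (𝓝 x1) (𝓝 (x1, y1, t1)) := by
      have : Continuous (fun y : Fin N → ℝ => (y, y1, t1)) := by fun_prop
      exact this.tendsto x1
    filter_upwards [c1.eventually hmax] with y hy
    have q := mul_le_mul_of_nonneg_left (quartic_tangent hp (nn_nonneg y1 y)) hL.le
    have e : L * (p + (nn y1 y - p ^ 4) / (4 * p ^ 3)) = L * p + α * (nn y1 y - p ^ 4) := by
      rw [hα]; field_simp
    rw [e] at q
    rw [hp4]
    linarith)
  -- touching at y1
  have hneg : ContDiff ℝ 2 (fun y => (0:ℝ) - v y t1) := contDiff_const.sub hc2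
  obtain ⟨gy, h3⟩ := touch_quad (x := y1) (a := x1) (b := x1) (α := α) (β := 0) hneg (by
    have c1 : Tendsto (fun y : Fin N → ℝ => (x1, y, t1)) (𝓝 y1) (𝓝 (x1, y1, t1)) := by
      have : Continuous (fun y : Fin N → ℝ => (x1, y, t1)) := by fun_prop
      exact this.tendsto y1
    filter_upwards [c1.eventually hmax] with y hy
    have q := mul_le_mul_of_nonneg_left (quartic_tangent hp (nn_nonneg y x1)) hL.le
    have e : L * (p + (nn y x1 - p ^ 4) / (4 * p ^ 3)) = L * p + α * (nn y x1 - p ^ 4) := by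
      rw [hα]; field_simp
    rw [e] at q
    rw [nn_comm x1 y1, nn_comm x1 y, hp4]
    linarith)
  have gy' : ∀ i, pd i (fun y => v y t1) y1 = 2 * α * d i := by
    intro i
    have := gy i
    rw [pd_sub contDiff_const hc1, show pd i (fun _ : Fin N → ℝ => (0:ℝ)) y1 = 0 by simp [pd]] at this
    simp only [hd]; linarith
  have gx' : ∀ i, pd i (fun y => v y t1) x1 = 2 * α * d i + 2 * (x1 i - x0 i) := by
    intro i; rw [gx i]; simp only [hd]; ring
  have h3' : ∀ ξ, -hess (fun y => v y t1) y1 ξ ≤ 2 * α * ∑ i, ξ i ^ 2 := by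
    intro ξ
    have := h3 ξ
    rw [hess_sub contDiff_const hc2, show hess (fun _ : Fin N → ℝ => (0:ℝ)) y1 ξ = 0 by
      simp [hess, pd2, pd]] at this
    linarith
  -- parallel direction
  have h1 : ∀ ξ, hess (fun y => v y t1) x1 ξ - hess (fun y => v y t1) y1 ξ ≤ 2 * ∑ i, ξ i ^ 2 := by
    intro ξ
    refine pair_hess hc2 x1 y1 ξ ξ ?_
    have hc : Continuous (fun s : ℝ => (x1 + s • ξ, y1 + s • ξ, t1)) := by fun_prop
    have c1 : Tendsto (fun s : ℝ => (x1 + s • ξ, y1 + s • ξ, t1)) (𝓝 0) (𝓝 (x1, y1, t1)) := by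
      simpa using hc.tendsto 0
    have c2 : Tendsto (fun s : ℝ => (x1 + (-s) • ξ, y1 + (-s) • ξ, t1)) (𝓝 0) (𝓝 (x1, y1, t1)) := by
      simpa [Function.comp_def] using (hc.comp continuous_neg).tendsto 0
    filter_upwards [c1.eventually hmax, c2.eventually hmax] with s k1 k2
    have hn : ∀ s : ℝ, nn (y1 + s • ξ) (x1 + s • ξ) = p ^ 4 := by
      intro s; rw [← hp4]; unfold nn; simp
    simp only [hn, hs4] at k1 k2
    have := nn_sym_diff x0 x1 ξ s
    linarith
  -- opposite direction
  have h4 : hess (fun y => v y t1) x1 d - hess (fun y => v y t1) y1 (-d) ≤ -L * p + 2 * p ^ 4 := by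
    refine pair_hess hc2 x1 y1 d (-d) ?_
    have hc : Continuous (fun s : ℝ => (x1 + s • d, y1 + s • (-d), t1)) := by fun_prop
    have c1 : Tendsto (fun s : ℝ => (x1 + s • d, y1 + s • (-d), t1)) (𝓝 0) (𝓝 (x1, y1, t1)) := by
      simpa using hc.tendsto 0
    have c2 : Tendsto (fun s : ℝ => (x1 + (-s) • d, y1 + (-s) • (-d), t1)) (𝓝 0)
        (𝓝 (x1, y1, t1)) := by
      simpa [Function.comp_def] using (hc.comp continuous_neg).tendsto 0
    have c3 : ∀ᶠ s in 𝓝 (0:ℝ), s ∈ Set.Ioo (-(1/2) : ℝ) (1/2) :=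
      Ioo_mem_nhds (by norm_num) (by norm_num)
    filter_upwards [c1.eventually hmax, c2.eventually hmax, c3] with s k1 k2 hs
    have hn : ∀ s : ℝ, 0 ≤ 1 + 2 * s → √(√(nn (y1 + s • (-d)) (x1 + s • d))) = p * √(1 + 2 * s) := by
      intro s hs
      have : nn (y1 + s • (-d)) (x1 + s • d) = ((1 + 2 * s) * p ^ 2) ^ 2 := by
        have : ((1 + 2 * s) * p ^ 2) ^ 2 = (1 + 2 * s) ^ 2 * ∑ i, d i ^ 2 := by rw [hdd]; ring
        rw [this, Finset.mul_sum]
        unfold nn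
        refine Finset.sum_congr rfl fun i _ => ?_
        simp [hd]; ring
      rw [this, Real.sqrt_sq (by positivity), Real.sqrt_mul hs, Real.sqrt_sq hp.le, mul_comm]
    simp only [hn s (by linarith [hs.1])] at k1
    simp only [hn (-s) (by linarith [hs.2])] at k2
    have e := nn_sym_diff x0 x1 d s
    rw [hdd] at e
    have sy := mul_le_mul_of_nonneg_left (sqrt_sym hs.1 hs.2) (by positivity : 0 ≤ L * p)
    rw [show 1 + 2 * -s = 1 - 2 * s by ring] at k2
    nlinarith
  have hneg' : hess (fun y => v y t1) y1 (-d) = hess (fun y => v y t1) y1 d := by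
    unfold hess; simp
  rw [hneg'] at h4
  have htr := trace_doubling (A₁ := fun i j => A i j x1) (A₂ := fun i j => A i j y1)
    (X := fun i j => pd2 i j (fun y => v y t1) x1) (Y := fun i j => pd2 i j (fun y => v y t1) y1)
    hQ.pos (fun i j => hQ.symm i j x1) (fun i j => hQ.symm i j y1) (hQ.ell x1)
    (fun i j => hQ.bA i j x1) hμ hμ0 hμ1 hp hdd hα0.le h1
    (fun ξ => by have := h2 ξ; rw [mul_one] at this; exact this) h3' h4
  -- drift
  have hB : ∑ i, B i x1 * pd i (fun y => v y t1) x1 - ∑ i, B i y1 * pd i (fun y => v y t1) y1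
      ≤ N * (CB * (2 * α * p ^ 2 + 2) + CB * (2 * α * p ^ 2)) := by
    rw [← Finset.sum_sub_distrib]
    have : ∑ i, (B i x1 * pd i (fun y => v y t1) x1 - B i y1 * pd i (fun y => v y t1) y1)
        ≤ ∑ _i : Fin N, (CB * (2 * α * p ^ 2 + 2) + CB * (2 * α * p ^ 2)) := by
      refine Finset.sum_le_sum fun i _ => ?_
      rw [gx' i, gy' i]
      have k0 : |2 * α * d i| ≤ 2 * α * p ^ 2 := by
        rw [abs_mul, abs_of_pos (by positivity : 0 < 2 * α)]
        exact mul_le_mul_of_nonneg_left (hdi i) (by positivity)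
      have k1 : |B i x1 * (2 * α * d i + 2 * (x1 i - x0 i))| ≤ CB * (2 * α * p ^ 2 + 2) := by
        rw [abs_mul]
        refine mul_le_mul (hQ.bB i x1) ?_ (abs_nonneg _) hQ.CB0
        refine (abs_add_le _ _).trans (add_le_add k0 ?_)
        rw [abs_mul, abs_two]; linarith [hx i]
      have k2 : |B i y1 * (2 * α * d i)| ≤ CB * (2 * α * p ^ 2) := by
        rw [abs_mul]
        exact mul_le_mul (hQ.bB i y1) k0 (abs_nonneg _) hQ.CB0
      linarith [(abs_le.1 k1).2, (abs_le.1 k2).1]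
    simpa [mul_add] using this
  have q1 := (abs_le.1 (hG x1 t1)).2
  have q2 := (abs_le.1 (hG y1 t1)).1
  unfold qOp at q1 q2
  have ht' := (abs_le.1 ht).1
  have e5 : a₀ / (2 * p ^ 4) * (-L * p + 2 * p ^ 4) = a₀ - 2 * α * a₀ := by
    rw [hLα]; field_simp; ring
  rw [e5] at htr
  nlinarith

lemma holder_num1 {n μ a : ℝ} (hn : 0 ≤ n) (hμ : 0 ≤ μ) (h : μ * (8 * (n + 1) ^ 2) = a) :
    n * μ ≤ a / 2 ∧ 2 * (n * μ * n) + 2 * (n * (μ + n * μ)) ≤ a / 2 := by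
  subst h
  have h1 : 0 ≤ n * μ := by positivity
  have h2 : 0 ≤ n * n * μ := by positivity
  constructor <;> nlinarith

lemma holder_num2 {a M L α e f : ℝ} (ha : 0 < a) (hM : 0 ≤ M) (hL : 4 * (M + 1) ≤ L * a)
    (h1 : L / 4 ≤ α) (h0 : 0 < α) (he : e ≤ a / 2) (hf : f ≤ a / 4)
    (h : 2 * α * a ≤ M + α * (e + f)) : False := by
  have e3 := mul_le_mul_of_nonneg_left (add_le_add he hf) h0.le
  have e4 := mul_le_mul_of_nonneg_right h1 ha.le
  nlinarith

lemma holder {N : ℕ} {A : Fin N → Fin N → (Fin N → ℝ) → ℝ} {B : Fin N → (Fin N → ℝ) → ℝ}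
    {a₀ CA CB : ℝ} (hQ : QC A B a₀ CA CB)
    (hA : ∀ μ > 0, ∃ r > 0, ∀ x y i j, nn y x ≤ r ^ 2 → |A i j y - A i j x| ≤ μ)
    {v : (Fin N → ℝ) → ℝ → ℝ} (hv : RegSol v) {K G : ℝ} (hK : ∀ x t, |v x t| ≤ K)
    (hG : ∀ x t, |qOp A B v x t| ≤ G) :
    ∃ L > 0, ∃ r > 0, ∀ x y t, nn y x ≤ r ^ 2 → v x t - v y t ≤ L * √(√(nn y x)) := by
  have ha := hQ.pos
  have hCA := hQ.CA0
  have hCB := hQ.CB0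
  have hK0 : 0 ≤ K := (abs_nonneg _).trans (hK 0 0)
  have hG0 : 0 ≤ G := (abs_nonneg _).trans (hG 0 0)
  have hN0 : (0:ℝ) ≤ N := Nat.cast_nonneg N
  set μ := a₀ / (8 * ((N:ℝ) + 1) ^ 2) with hμ
  have hμ0 : 0 < μ := by positivity
  have hμe : μ * (8 * ((N:ℝ) + 1) ^ 2) = a₀ := by rw [hμ]; field_simp
  obtain ⟨r1, hr1, hA1⟩ := hA μ hμ0
  set c1 := a₀ / (16 * (N * CB + 1)) with hc1
  have hc1p : 0 < c1 := by positivity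
  have hc1e : c1 * (16 * (N * CB + 1)) = a₀ := by rw [hc1]; field_simp
  obtain ⟨r0, hr0, hr01, hr0r, hr0c⟩ : ∃ r0 > 0, r0 ≤ 1 ∧ r0 ≤ r1 ∧ r0 ≤ c1 :=
    ⟨min 1 (min r1 c1), by positivity, min_le_left _ _, (min_le_right _ _).trans (min_le_left _ _),
      (min_le_right _ _).trans (min_le_right _ _)⟩
  set M0 := 2 + 2 * G + 2 * (N * CA) + 2 * (N * μ * N) + a₀ + 2 * (N * CB) with hM0
  have hM00 : 0 ≤ M0 := by positivity
  have hsr : 0 < √r0 := Real.sqrt_pos.2 hr0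
  set L := 4 * (M0 + 1) / a₀ + 2 * K / √r0 with hL
  have hL0 : 0 < L := by positivity
  have hL1 : 4 * (M0 + 1) ≤ L * a₀ := by
    have : L * a₀ = 4 * (M0 + 1) + 2 * K / √r0 * a₀ := by rw [hL]; field_simp
    rw [this]; have : 0 ≤ 2 * K / √r0 * a₀ := by positivity
    linarith
  have hL2 : 2 * K ≤ L * √r0 := by
    have : L * √r0 = 2 * K + 4 * (M0 + 1) / a₀ * √r0 := by rw [hL]; field_simp; ring
    rw [this]; have : 0 ≤ 4 * (M0 + 1) / a₀ * √r0 := by positivity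
    linarith
  refine ⟨L, hL0, r0, hr0, ?_⟩
  by_contra hcon
  push Not at hcon
  obtain ⟨x', y', t', hn', hΦ'⟩ := hcon
  set Φ : (Fin N → ℝ) × (Fin N → ℝ) × ℝ → ℝ := fun q =>
    v q.1 q.2.2 - v q.2.1 q.2.2 - L * √(√(nn q.2.1 q.1)) with hΦ
  set S : Set ℝ := Φ '' {q | nn q.2.1 q.1 ≤ r0 ^ 2} with hS
  have hvK : ∀ x y t, v x t - v y t ≤ 2 * K := fun x y t => by
    linarith [(abs_le.1 (hK x t)).2, (abs_le.1 (hK y t)).1]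
  have hSb : BddAbove S := by
    refine ⟨2 * K, ?_⟩
    rintro _ ⟨q, -, rfl⟩
    have : 0 ≤ L * √(√(nn q.2.1 q.1)) := by positivity
    have := hvK q.1 q.2.1 q.2.2
    simp only [hΦ]; linarith
  have hS' : Φ (x', y', t') ∈ S := ⟨(x', y', t'), hn', rfl⟩
  have hpos : 0 < Φ (x', y', t') := by simp only [hΦ]; linarith
  have hσ : 0 < sSup S := hpos.trans_le (le_csSup hSb hS')
  obtain ⟨_, ⟨⟨x0, y0, t0⟩, hq0, rfl⟩, hq0'⟩ := exists_lt_of_lt_csSup ⟨_, hS'⟩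
    (show max (sSup S - 1) 0 < sSup S from max_lt (by linarith) hσ)
  have hP0 : 0 < Φ (x0, y0, t0) := (le_max_right _ _).trans_lt hq0'
  have hP1 : sSup S - 1 < Φ (x0, y0, t0) := (le_max_left _ _).trans_lt hq0'
  have hcn : Continuous (fun q : (Fin N → ℝ) × (Fin N → ℝ) × ℝ => nn q.2.1 q.1) := by
    unfold nn; fun_prop
  have hcn0 : Continuous (fun q : (Fin N → ℝ) × (Fin N → ℝ) × ℝ => nn x0 q.1) := by
    unfold nn; fun_prop
  set Kc : Set ((Fin N → ℝ) × (Fin N → ℝ) × ℝ) :=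
    {q | nn x0 q.1 ≤ 1 ∧ nn q.2.1 q.1 ≤ r0 ^ 2 ∧ (q.2.2 - t0) ^ 2 ≤ 1} with hKc
  have hcl : IsClosed Kc := by
    have c3 : Continuous (fun q : (Fin N → ℝ) × (Fin N → ℝ) × ℝ => (q.2.2 - t0) ^ 2) := by fun_prop
    exact (isClosed_le hcn0 continuous_const).inter
      ((isClosed_le hcn continuous_const).inter (isClosed_le c3 continuous_const))
  have hcomp : IsCompact Kc := by
    refine IsCompact.of_isClosed_subset ((isCompact_closedBall x0 1).prod
      ((isCompact_closedBall x0 2).prod (isCompact_closedBall t0 1))) hcl ?_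
    rintro ⟨x, y, t⟩ ⟨h1, h2, h3⟩
    simp only at h1 h2 h3
    have k1 : ‖x - x0‖ ≤ 1 := norm_le_of_nn zero_le_one (by simpa using h1)
    have k2 : ‖x - y‖ ≤ 1 := norm_le_of_nn zero_le_one (h2.trans (by gcongr))
    refine ⟨by simpa [dist_eq_norm] using k1, ?_, ?_⟩
    · simp only [Metric.mem_closedBall, dist_eq_norm]
      calc ‖y - x0‖ = ‖(x - x0) - (x - y)‖ := by congr 1; abel
        _ ≤ 1 + 1 := (norm_sub_le _ _).trans (add_le_add k1 k2)
        _ = 2 := by norm_num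
    · simp only [Metric.mem_closedBall, Real.dist_eq]
      exact abs_le_of_sq_le_sq (by simpa using h3) zero_le_one
  have hvc := hv.1
  have hΦc : Continuous Φ := by
    have e1 : Continuous (fun q : (Fin N → ℝ) × (Fin N → ℝ) × ℝ => v q.1 q.2.2) :=
      hvc.comp (by fun_prop : Continuous fun q : (Fin N → ℝ) × (Fin N → ℝ) × ℝ => (q.1, q.2.2))
    have e2 : Continuous (fun q : (Fin N → ℝ) × (Fin N → ℝ) × ℝ => v q.2.1 q.2.2) :=
      hvc.comp (by fun_prop : Continuous fun q : (Fin N → ℝ) × (Fin N → ℝ) × ℝ => (q.2.1, q.2.2))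
    exact (e1.sub e2).sub (continuous_const.mul (hcn.sqrt.sqrt))
  have hΘc : Continuous (fun q => Φ q - nn x0 q.1 - (q.2.2 - t0) ^ 2) := by
    refine (hΦc.sub hcn0).sub ?_
    fun_prop
  have hq0K : (x0, y0, t0) ∈ Kc := ⟨by simp [nn], hq0, by simp⟩
  obtain ⟨⟨x1, y1, t1⟩, hq1, hmax⟩ := hcomp.exists_isMaxOn ⟨_, hq0K⟩ hΘc.continuousOn
  have hm0 := hmax hq0K
  simp only [Set.mem_ofPred_eq] at hm0
  have hz : nn x0 x0 = 0 := by simp [nn]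
  rw [hz] at hm0
  have hle : Φ (x1, y1, t1) ≤ sSup S := le_csSup hSb ⟨_, hq1.2.1, rfl⟩
  have hnn0 := nn_nonneg x0 x1
  have hst0 := sq_nonneg (t1 - t0)
  have hi1 : nn x0 x1 < 1 := by linarith
  have hi3 : (t1 - t0) ^ 2 < 1 := by linarith
  have hpos1 : 0 < Φ (x1, y1, t1) := by linarith
  have hn1 := nn_nonneg y1 x1
  have hne : nn y1 x1 ≠ 0 := by
    intro h0
    have : ‖x1 - y1‖ ≤ 0 := norm_le_of_nn le_rfl (by rw [h0]; norm_num)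
    have : x1 = y1 := by
      have := norm_le_zero_iff.1 this
      exact sub_eq_zero.1 this
    rw [this] at hpos1
    simp only [hΦ] at hpos1
    have : 0 ≤ L * √(√(nn y1 y1)) := by positivity
    linarith
  have hnpos : 0 < nn y1 x1 := lt_of_le_of_ne hn1 (Ne.symm hne)
  have hi2 : nn y1 x1 < r0 ^ 2 := by
    refine lt_of_le_of_ne hq1.2.1 fun h0 => ?_
    simp only [hΦ] at hpos1
    rw [h0, Real.sqrt_sq hr0.le] at hpos1
    linarith [hvK x1 y1 t1]
  set p := √(√(nn y1 x1)) with hp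
  have hp0 : 0 < p := Real.sqrt_pos.2 (Real.sqrt_pos.2 hnpos)
  have hp2 : p ^ 2 = √(nn y1 x1) := Real.sq_sqrt (Real.sqrt_nonneg _)
  have hp4 : nn y1 x1 = p ^ 4 := by
    rw [show p ^ 4 = (p ^ 2) ^ 2 by ring, hp2, Real.sq_sqrt hn1]
  have hp2r : p ^ 2 ≤ r0 := by
    rw [hp2, Real.sqrt_le_left hr0.le]; exact hi2.le
  have hp1 : p ≤ 1 := abs_le_of_sq_le_sq' (by linarith) zero_le_one |>.2
  have hev : ∀ᶠ q : (Fin N → ℝ) × (Fin N → ℝ) × ℝ in 𝓝 (x1, y1, t1), q ∈ Kc := by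
    have o1 : ∀ᶠ q : (Fin N → ℝ) × (Fin N → ℝ) × ℝ in 𝓝 (x1, y1, t1), nn x0 q.1 < 1 :=
      (hcn0.tendsto (x1, y1, t1)).eventually_lt_const hi1
    have o2 : ∀ᶠ q : (Fin N → ℝ) × (Fin N → ℝ) × ℝ in 𝓝 (x1, y1, t1), nn q.2.1 q.1 < r0 ^ 2 :=
      (hcn.tendsto (x1, y1, t1)).eventually_lt_const hi2
    have o3 : ∀ᶠ q : (Fin N → ℝ) × (Fin N → ℝ) × ℝ in 𝓝 (x1, y1, t1), (q.2.2 - t0) ^ 2 < 1 := by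
      have : Continuous (fun q : (Fin N → ℝ) × (Fin N → ℝ) × ℝ => (q.2.2 - t0) ^ 2) := by fun_prop
      exact (this.tendsto (x1, y1, t1)).eventually_lt_const hi3
    filter_upwards [o1, o2, o3] with q a b c
    exact ⟨a.le, b.le, c.le⟩
  obtain ⟨hNμ, e1⟩ := holder_num1 hN0 hμ0.le hμe
  have hfin := holder_core hQ hv hG (x0 := x0) (x1 := x1) (y1 := y1) (t0 := t0) (t1 := t1)
    (μ := μ) hL0 hp0 hp4 (fun i => abs_le_of_nn zero_le_one (by simpa using hi1.le) i)
    (abs_le_of_sq_le_sq (by simpa using hi3.le) zero_le_one)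
    (fun i j => hA1 x1 y1 i j (hi2.le.trans (by gcongr))) hμ0.le hNμ (by
      filter_upwards [hev] with q hq
      exact hmax hq)
  rw [← hM0] at hfin
  set α := L / (4 * p ^ 3) with hα
  have hα1 : L / 4 ≤ α := by
    rw [hα]
    refine div_le_div_of_nonneg_left hL0.le (by positivity) ?_
    have : p ^ 3 ≤ 1 := pow_le_one₀ hp0.le hp1
    linarith
  have hα0 : 0 < α := by positivity
  have e2 : 4 * (N * CB) * p ^ 2 ≤ a₀ / 4 := by
    have h1 : 4 * (N * CB) * p ^ 2 ≤ 4 * (N * CB) * c1 :=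
      mul_le_mul_of_nonneg_left (hp2r.trans hr0c) (by positivity)
    have h2 : c1 * (16 * (N * CB + 1)) = 4 * (4 * (N * CB) * c1) + 16 * c1 := by ring
    linarith
  exact holder_num2 ha hM00 hL1 hα1 hα0 e1 e2 hfin

lemma nn_le_norm {N : ℕ} (x y : Fin N → ℝ) : nn y x ≤ N * ‖x - y‖ ^ 2 := by
  have : nn y x ≤ ∑ _i : Fin N, ‖x - y‖ ^ 2 := by
    refine Finset.sum_le_sum fun i _ => ?_
    have := norm_le_pi_norm (x - y) i
    simp only [Pi.sub_apply, Real.norm_eq_abs] at this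
    rw [← sq_abs]
    gcongr
  simpa using this

/-- Spatial modulus. -/
def SMod {N : ℕ} (v : (Fin N → ℝ) → ℝ → ℝ) : Prop :=
  ∀ ε > 0, ∃ ρ > 0, ∀ x y t, ‖x - y‖ ≤ ρ → |v x t - v y t| ≤ ε

lemma smod_of_holder {N : ℕ} {v : (Fin N → ℝ) → ℝ → ℝ}
    (h : ∃ L > 0, ∃ r > 0, ∀ x y t, nn y x ≤ r ^ 2 → v x t - v y t ≤ L * √(√(nn y x))) :
    SMod v := by
  obtain ⟨L, hL, r, hr, h⟩ := h
  intro ε hε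
  have hlim : Tendsto (fun ρ : ℝ => L * √(√(N * ρ ^ 2))) (𝓝 0) (𝓝 0) := by
    have : Continuous (fun ρ : ℝ => L * √(√(N * ρ ^ 2))) := by fun_prop
    simpa using this.tendsto 0
  have hlim2 : Tendsto (fun ρ : ℝ => N * ρ ^ 2) (𝓝 0) (𝓝 0) := by
    have : Continuous (fun ρ : ℝ => N * ρ ^ 2) := by fun_prop
    simpa using this.tendsto 0
  have hev := (hlim.eventually_lt_const hε).and (hlim2.eventually_lt_const (by positivity : 0 < r ^ 2))
  obtain ⟨ρ, ⟨h1, h2⟩, hρ⟩ := ((hev.filter_mono nhdsWithin_le_nhds).and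
    (self_mem_nhdsWithin : Set.Ioi (0:ℝ) ∈ 𝓝[>] (0:ℝ))).exists
  refine ⟨ρ, hρ, fun x y t hxy => ?_⟩
  have key : ∀ x y : Fin N → ℝ, ‖x - y‖ ≤ ρ → v x t - v y t ≤ ε := by
    intro x y hxy
    have k : nn y x ≤ N * ρ ^ 2 := (nn_le_norm x y).trans (by gcongr)
    refine (h x y t (k.trans h2.le)).trans (le_trans ?_ h1.le)
    gcongr
  rw [abs_le]
  constructor
  · have := key y x (by rwa [norm_sub_rev]); linarith
  · exact key x y hxy

/-- Space-time translate. -/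
def trl {N : ℕ} (w : (Fin N → ℝ) → ℝ → ℝ) (z : Fin N → ℝ) (h : ℝ) : (Fin N → ℝ) → ℝ → ℝ :=
  fun x t => w (x + z) (t + h)

lemma RegSol.reg0 {N : ℕ} {w : (Fin N → ℝ) → ℝ → ℝ} (hw : RegSol w) : Reg0 w := hw.2

lemma RegSol.trl {N : ℕ} {w : (Fin N → ℝ) → ℝ → ℝ} (hw : RegSol w) (z : Fin N → ℝ) (h : ℝ) :
    RegSol (trl w z h) := by
  refine ⟨?_, fun x => ?_, fun t => ?_⟩
  · exact hw.1.comp (by fun_prop : Continuous fun p : (Fin N → ℝ) × ℝ => (p.1 + z, p.2 + h))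
  · exact (hw.2.1 (x + z)).comp (differentiable_id.add_const h)
  · exact (hw.2.2 (t + h)).comp (contDiff_id.add contDiff_const)

lemma RegSol.sub {N : ℕ} {u v : (Fin N → ℝ) → ℝ → ℝ} (hu : RegSol u) (hv : RegSol v) :
    RegSol (fun x t => u x t - v x t) :=
  ⟨hu.1.sub hv.1, hu.2.1 |> fun h x => (h x).fun_sub (hv.2.1 x), fun t => (hu.2.2 t).sub (hv.2.2 t)⟩

lemma regSol_const {N : ℕ} (k : ℝ) : RegSol (fun (_ : Fin N → ℝ) (_ : ℝ) => k) :=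
  ⟨continuous_const, fun _ => differentiable_const k, fun _ => contDiff_const⟩

lemma pd_trl {N : ℕ} (φ : (Fin N → ℝ) → ℝ) (z : Fin N → ℝ) (i : Fin N) (x : Fin N → ℝ) :
    pd i (fun y => φ (y + z)) x = pd i φ (x + z) := by
  unfold pd; rw [fderiv_comp_add_right]

lemma pd2_trl {N : ℕ} (φ : (Fin N → ℝ) → ℝ) (z : Fin N → ℝ) (i j : Fin N) (x : Fin N → ℝ) :
    pd2 i j (fun y => φ (y + z)) x = pd2 i j φ (x + z) := by
  unfold pd2
  simp_rw [pd_trl]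

lemma qOp_trl {N : ℕ} {A : Fin N → Fin N → (Fin N → ℝ) → ℝ} {B : Fin N → (Fin N → ℝ) → ℝ}
    (w : (Fin N → ℝ) → ℝ → ℝ) {z : Fin N → ℝ} (h : ℝ) (hA : ∀ i j x, A i j (x + z) = A i j x)
    (hB : ∀ i x, B i (x + z) = B i x) (x : Fin N → ℝ) (t : ℝ) :
    qOp A B (trl w z h) x t = qOp A B w (x + z) (t + h) := by
  unfold qOp trl
  rw [deriv_comp_add_const (fun s => w (x + z) s) h t]
  simp_rw [fun i j => pd2_trl (fun y => w y (t + h)) z i j x,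
    fun i => pd_trl (fun y => w y (t + h)) z i x, hA, hB]

lemma qOp_const_sub {N : ℕ} (A : Fin N → Fin N → (Fin N → ℝ) → ℝ) (B : Fin N → (Fin N → ℝ) → ℝ)
    {w : (Fin N → ℝ) → ℝ → ℝ} (hw : RegSol w) (k : ℝ) (x : Fin N → ℝ) (t : ℝ) :
    qOp A B (fun x t => k - w x t) x t = - qOp A B w x t := by
  rw [qOp_sub A B (reg0_const k) hw.reg0, qOp_const]; ring

/-- Class of functions for the quantitative Liouville lemma. -/
structure Cls {N : ℕ} (W : Set ((Fin N → ℝ) → ℝ → ℝ)) (K : ℝ) : Prop where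
  reg : ∀ w ∈ W, RegSol w
  bd : ∀ w ∈ W, ∀ x t, |w x t| ≤ K
  mod : ∀ ε > 0, ∃ ρ > 0, ∀ w ∈ W, ∀ x y t, ‖x - y‖ ≤ ρ → |w x t - w y t| ≤ ε

/-- Period group of the coefficients. -/
structure PG {N : ℕ} (A : Fin N → Fin N → (Fin N → ℝ) → ℝ) (B : Fin N → (Fin N → ℝ) → ℝ)
    (Lt : AddSubgroup (Fin N → ℝ)) (ℓ : ℝ) : Prop where
  hA : ∀ z ∈ Lt, ∀ i j x, A i j (x + z) = A i j x
  hB : ∀ z ∈ Lt, ∀ i x, B i (x + z) = B i x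
  ℓ0 : 0 ≤ ℓ
  red : ∀ x y : Fin N → ℝ, ∃ z ∈ Lt, ‖x + z - y‖ ≤ ℓ

lemma liou_shift {N : ℕ} {A : Fin N → Fin N → (Fin N → ℝ) → ℝ} {B : Fin N → (Fin N → ℝ) → ℝ}
    {a₀ CA CB : ℝ} (hQ : QC A B a₀ CA CB) {Lt : AddSubgroup (Fin N → ℝ)} {ℓ : ℝ}
    (hP : PG A B Lt ℓ) {W : Set ((Fin N → ℝ) → ℝ → ℝ)} {K : ℝ} (hW : Cls W K)
    {R0 ε : ℝ} (hR0 : 0 ≤ R0) (hε : 0 < ε) :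
    ∃ η > 0, ∀ w ∈ W, (∀ x t, |qOp A B w x t| ≤ η) → ∀ z ∈ Lt, ∀ h : ℝ, ‖z‖ ≤ R0 → |h| ≤ R0 →
      ∀ x t, w (x + z) (t + h) - w x t ≤ ε := by
  obtain ⟨n, hn⟩ := exists_nat_gt (4 * K / ε)
  have hn' : 2 * K < n * (ε / 2) := by
    rw [div_lt_iff₀ hε] at hn; linarith
  obtain ⟨ρ, hρ, hmod⟩ := hW.mod (ε / 8) (by linarith)
  obtain ⟨δ, hδ, hprop⟩ := propagate hQ hρ (R := n * R0) (T := 1 + 2 * (n * R0)) (ε := ε / 4)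
    (by positivity) (by positivity) (by linarith)
  refine ⟨δ / 2, by linarith, fun w hw hq z hz h hzR hhR => ?_⟩
  have hwr := hW.reg w hw
  have hwb := hW.bd w hw
  set d : (Fin N → ℝ) → ℝ → ℝ := fun x t => trl w z h x t - w x t with hd
  have hdr : RegSol d := (hwr.trl z h).sub hwr
  have hdb : BddAbove (Set.range fun p : (Fin N → ℝ) × ℝ => d p.1 p.2) := by
    refine ⟨2 * K, ?_⟩
    rintro _ ⟨p, rfl⟩
    have h1 := (abs_le.1 (hwb (p.1 + z) (p.2 + h))).2
    have h2 := (abs_le.1 (hwb p.1 p.2)).1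
    simp only [hd, trl]; linarith
  set S := ⨆ p : (Fin N → ℝ) × ℝ, d p.1 p.2 with hS
  have hdS : ∀ x t, d x t ≤ S := fun x t => le_ciSup hdb (x, t)
  suffices hSε : S ≤ ε from fun x t => (hdS x t).trans hSε
  by_contra hlt
  push Not at hlt
  obtain ⟨⟨x0, t0⟩, hx0⟩ := exists_lt_of_lt_ciSup (show S - δ < S by linarith)
  simp only at hx0
  have hdmod : ∀ x y t, ‖x - y‖ ≤ ρ → |d x t - d y t| ≤ ε / 4 := by
    intro x y t hxy
    have h1 := abs_le.1 (hmod w hw (x + z) (y + z) (t + h) (by simpa using hxy))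
    have h2 := abs_le.1 (hmod w hw x y t hxy)
    simp only [hd, trl]
    rw [abs_le]; constructor <;> linarith [h1.1, h1.2, h2.1, h2.2]
  have hpt := hprop (fun x t => S - d x t) ((regSol_const S).sub hdr) x0 t0
    (fun x t _ _ _ => by have := hdS x t; linarith)
    (fun x t _ _ _ => by
      rw [qOp_const_sub A B hdr, hd, qOp_sub A B (hwr.trl z h).reg0 hwr.reg0,
        qOp_trl w h (hP.hA z hz) (hP.hB z hz)]
      have h1 := (abs_le.1 (hq (x + z) (t + h))).2
      have h2 := (abs_le.1 (hq x t)).1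
      linarith)
    (by linarith)
  have hbig : ∀ y s, ‖y - x0‖ ≤ n * R0 → t0 - (1 + 2 * (n * R0)) ≤ s → s ≤ t0 - 1 →
      ε / 2 ≤ d y s := by
    intro y s h1 h2 h3
    obtain ⟨x, hx, hx'⟩ := hpt y s h1 h2 h3
    have := (abs_le.1 (hdmod x y s hx)).2
    linarith
  have hind : ∀ k : ℕ, k ≤ n → w x0 (t0 - 1 - n * R0) + k * (ε / 2)
      ≤ w (x0 + (k:ℝ) • z) (t0 - 1 - n * R0 + k * h) := by
    intro k
    induction k with
    | zero => intro _; simp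
    | succ k ih =>
      intro hk
      have hkn : (k:ℝ) ≤ n := by exact_mod_cast (Nat.le_of_succ_le hk)
      have ih' := ih (Nat.le_of_succ_le hk)
      have hkh : |(k:ℝ) * h| ≤ n * R0 := by
        rw [abs_mul, Nat.abs_cast]
        exact mul_le_mul hkn hhR (abs_nonneg _) (by positivity)
      have hb := hbig (x0 + (k:ℝ) • z) (t0 - 1 - n * R0 + k * h) (by
          rw [add_sub_cancel_left, norm_smul, Real.norm_eq_abs, Nat.abs_cast]
          exact mul_le_mul hkn hzR (norm_nonneg _) (by positivity))
        (by linarith [(abs_le.1 hkh).1]) (by linarith [(abs_le.1 hkh).2])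
      simp only [hd, trl] at hb
      have e1 : x0 + ((k + 1 : ℕ) : ℝ) • z = x0 + (k:ℝ) • z + z := by
        push_cast; rw [add_smul, one_smul, add_assoc]
      have e2 : t0 - 1 - n * R0 + ((k + 1 : ℕ) : ℝ) * h = t0 - 1 - n * R0 + k * h + h := by
        push_cast; ring
      rw [e1, e2]
      push_cast
      linarith
  have := hind n le_rfl
  have h1 := (abs_le.1 (hwb (x0 + (n:ℝ) • z) (t0 - 1 - n * R0 + n * h))).2
  have h2 := (abs_le.1 (hwb x0 (t0 - 1 - n * R0))).1
  linarith

lemma liou_osc {N : ℕ} {A : Fin N → Fin N → (Fin N → ℝ) → ℝ} {B : Fin N → (Fin N → ℝ) → ℝ}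
    {a₀ CA CB : ℝ} (hQ : QC A B a₀ CA CB) {Lt : AddSubgroup (Fin N → ℝ)} {ℓ : ℝ}
    (hP : PG A B Lt ℓ) {W : Set ((Fin N → ℝ) → ℝ → ℝ)} {K : ℝ} (hW : Cls W K)
    {R ε : ℝ} (hR : 0 ≤ R) (hε : 0 < ε) :
    ∃ η > 0, ∀ w ∈ W, (∀ x t, |qOp A B w x t| ≤ η) → ∀ x y t s, ‖x - y‖ ≤ R → |t - s| ≤ R →
      w x t - w y s ≤ ε := by
  have hℓ := hP.ℓ0
  obtain ⟨ρ, hρ, hmod⟩ := hW.mod (ε / 2) (by linarith)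
  obtain ⟨δ, hδ, hprop⟩ := propagate hQ hρ (R := ℓ) (T := 1) (ε := ε / 2) hℓ zero_le_one
    (by linarith)
  obtain ⟨η, hη, hsh⟩ := liou_shift hQ hP hW (R0 := 3 * ℓ + ρ + R + 1) (by positivity) hδ
  refine ⟨min η δ, lt_min hη hδ, fun w hw hq x y t s hxy hts => ?_⟩
  have hsh' := hsh w hw fun x t => (hq x t).trans (min_le_left _ _)
  have hwr := hW.reg w hw
  obtain ⟨x0, hx0, hmax⟩ := (isCompact_closedBall y ℓ).exists_isMaxOn
    ⟨y, Metric.mem_closedBall_self hℓ⟩ (hwr.2.2 (s + 1)).continuous.continuousOn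
  rw [Metric.mem_closedBall, dist_eq_norm] at hx0
  have hup : ∀ x' t', ‖x' - y‖ ≤ 2 * ℓ + ρ + R → |t' - (s + 1)| ≤ R + 1 →
      w x' t' ≤ w x0 (s + 1) + δ := by
    intro x' t' h1 h2
    obtain ⟨z, hz, hzl⟩ := hP.red x' y
    have hm : w (x' + z) (s + 1) ≤ w x0 (s + 1) :=
      hmax (by rw [Metric.mem_closedBall, dist_eq_norm]; exact hzl)
    have hzn : ‖-z‖ ≤ 3 * ℓ + ρ + R + 1 := by
      rw [norm_neg]
      calc ‖z‖ = ‖(x' + z - y) - (x' - y)‖ := by congr 1; abel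
        _ ≤ ℓ + (2 * ℓ + ρ + R) := (norm_sub_le _ _).trans (add_le_add hzl h1)
        _ ≤ _ := by linarith
    have := hsh' (-z) (Lt.neg_mem hz) (t' - (s + 1)) hzn (h2.trans (by linarith)) (x' + z) (s + 1)
    rw [add_neg_cancel_right, add_sub_cancel] at this
    linarith
  have hpt := hprop (fun x t => w x0 (s + 1) + δ - w x t) ((regSol_const _).sub hwr) x0 (s + 1)
    (fun x' t' h1 h2 h3 => by
      have := hup x' t' (by
        calc ‖x' - y‖ = ‖(x' - x0) + (x0 - y)‖ := by congr 1; abel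
          _ ≤ (ℓ + ρ) + ℓ := (norm_add_le _ _).trans (add_le_add h1 hx0)
          _ ≤ _ := by linarith) (by rw [abs_le]; constructor <;> linarith)
      linarith)
    (fun x' t' _ _ _ => by
      rw [qOp_const_sub A B hwr]
      have := (abs_le.1 ((hq x' t').trans (min_le_right _ _))).2
      linarith)
    (by linarith) y s (by rwa [norm_sub_rev]) (by linarith) (by linarith)
  obtain ⟨x', hx', hlt⟩ := hpt
  have h1 := (abs_le.1 (hmod w hw x' y s hx')).2
  have h2 := hup x t (by linarith) (by
    have := abs_le.1 hts
    rw [abs_le]; constructor <;> linarith [this.1, this.2])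
  linarith

/-- `τ = (z,h)` is an `η`-almost period of `g`. -/
def APer {N : ℕ} (g : (Fin N → ℝ) → ℝ → ℝ) (η : ℝ) (z : Fin N → ℝ) (h : ℝ) : Prop :=
  ∀ x t, |g (x + z) (t + h) - g x t| ≤ η

lemma APer.neg {N : ℕ} {g : (Fin N → ℝ) → ℝ → ℝ} {η : ℝ} {z : Fin N → ℝ} {h : ℝ}
    (H : APer g η z h) : APer g η (-z) (-h) := by
  intro x t
  have := H (x + -z) (t + -h)
  rw [neg_add_cancel_right, neg_add_cancel_right, abs_sub_comm] at this
  exact this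

lemma aper_of_pair {N : ℕ} {g : (Fin N → ℝ) → ℝ → ℝ} {η : ℝ} {z z' : Fin N → ℝ} {h h' : ℝ}
    (H : ∀ x t, |g (x + z) (t + h) - g (x + z') (t + h')| ≤ η) : APer g η (z - z') (h - h') := by
  intro x t
  have := H (x - z') (t - h')
  rw [sub_add_cancel, sub_add_cancel] at this
  rwa [show x + (z - z') = x - z' + z by abel, show t + (h - h') = t - h' + h by abel]

lemma pair_of_aper {N : ℕ} {g : (Fin N → ℝ) → ℝ → ℝ} {η : ℝ} {z z' : Fin N → ℝ} {h h' : ℝ}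
    (H : APer g η (z - z') (h - h')) (x : Fin N → ℝ) (t : ℝ) :
    |g (x + z) (t + h) - g (x + z') (t + h')| ≤ η := by
  have := H (x + z') (t + h')
  rwa [show x + z' + (z - z') = x + z by abel, show t + h' + (h - h') = t + h by abel] at this

/-- Precompactness of the translates along `Lt × ℝ`. -/
def GP {N : ℕ} (Lt : AddSubgroup (Fin N → ℝ)) (g : (Fin N → ℝ) → ℝ → ℝ) : Prop :=
  ∀ S : ℕ → (Fin N → ℝ) × ℝ, (∀ n, (S n).1 ∈ Lt) → ∃ k : ℕ → ℕ, StrictMono k ∧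
    ∀ ε > 0, ∃ M : ℕ, ∀ n ≥ M, ∀ m ≥ M,
      APer g ε ((S (k n)).1 - (S (k m)).1) ((S (k n)).2 - (S (k m)).2)

lemma gp_of_ap {N : ℕ} (Lt : AddSubgroup (Fin N → ℝ)) {g : (Fin N → ℝ) → ℝ → ℝ}
    (h : APfun fun p : (Fin N → ℝ) × ℝ => g p.1 p.2) : GP Lt g := by
  intro S _
  obtain ⟨k, hk, ψ, hψ⟩ := h.2 S
  refine ⟨k, hk, fun ε hε => ?_⟩
  obtain ⟨M, hM⟩ := eventually_atTop.1 (Metric.tendstoUniformly_iff.1 hψ (ε / 2) (by linarith))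
  refine ⟨M, fun n hn m hm => aper_of_pair fun x t => ?_⟩
  have h1 := hM n hn (x, t)
  have h2 := hM m hm (x, t)
  rw [Real.dist_eq] at h1 h2
  simp only [Prod.fst_add, Prod.snd_add] at h1 h2
  have h1 := abs_lt.1 h1
  have h2 := abs_lt.1 h2
  rw [abs_le]; constructor <;> linarith [h1.1, h1.2, h2.1, h2.2]

lemma ap_bdd {N : ℕ} {g : (Fin N → ℝ) → ℝ → ℝ}
    (h : APfun fun p : (Fin N → ℝ) × ℝ => g p.1 p.2) : ∃ G, ∀ x t, |g x t| ≤ G := by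
  by_contra hcon
  push Not at hcon
  choose x t hxt using fun n : ℕ => hcon n
  obtain ⟨k, hk, ψ, hψ⟩ := h.2 fun n => (x n, t n)
  obtain ⟨M, hM⟩ := eventually_atTop.1 (Metric.tendstoUniformly_iff.1 hψ 1 one_pos)
  obtain ⟨n, hn⟩ := exists_nat_gt (|ψ 0| + 1)
  have h1 := hM (max M n) (le_max_left _ _) 0
  rw [Real.dist_eq] at h1
  simp only [zero_add] at h1
  have h2 := hxt (k (max M n))
  have h3 : (n:ℝ) ≤ k (max M n) := by
    exact_mod_cast (le_max_right M n).trans (hk.le_apply)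
  have h4 := abs_sub_abs_le_abs_sub (g (x (k (max M n))) (t (k (max M n)))) (ψ 0)
  rw [abs_sub_comm] at h1
  linarith

lemma GP.mul {N : ℕ} {Lt : AddSubgroup (Fin N → ℝ)} {g : (Fin N → ℝ) → ℝ → ℝ} (hg : GP Lt g)
    {ψ : (Fin N → ℝ) → ℝ} {c : ℝ} (hc : ∀ x, |ψ x| ≤ c) (hper : ∀ z ∈ Lt, ∀ x, ψ (x + z) = ψ x) :
    GP Lt (fun x t => g x t * ψ x) := by
  have hc0 : 0 ≤ c := (abs_nonneg _).trans (hc 0)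
  intro S hS
  obtain ⟨k, hk, H⟩ := hg S hS
  refine ⟨k, hk, fun ε hε => ?_⟩
  obtain ⟨M, hM⟩ := H (ε / (c + 1)) (by positivity)
  refine ⟨M, fun n hn m hm x t => ?_⟩
  have h1 := hM n hn m hm x t
  beta_reduce
  rw [hper _ (Lt.sub_mem (hS _) (hS _)), ← sub_mul, abs_mul]
  calc _ ≤ ε / (c + 1) * (c + 1) := by
        exact mul_le_mul h1 ((hc x).trans (by linarith)) (abs_nonneg _) (by positivity)
    _ = ε := by field_simp

lemma gp_star {N : ℕ} {Lt : AddSubgroup (Fin N → ℝ)} {g v : (Fin N → ℝ) → ℝ → ℝ} (hg : GP Lt g)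
    (hs : ∀ ε > 0, ∃ η > 0, ∀ z ∈ Lt, ∀ h, APer g η z h → ∀ x t, -ε ≤ v (x + z) (t + h) - v x t) :
    GP Lt v := by
  intro S hS
  obtain ⟨k, hk, H⟩ := hg S hS
  refine ⟨k, hk, fun ε hε => ?_⟩
  obtain ⟨η, hη, hs⟩ := hs ε hε
  obtain ⟨M, hM⟩ := H η hη
  refine ⟨M, fun n hn m hm x t => ?_⟩
  have h1 := hs _ (Lt.sub_mem (hS _) (hS _)) _ (hM n hn m hm) x t
  have h2 := hs _ (Lt.neg_mem (Lt.sub_mem (hS _) (hS _))) _ (hM n hn m hm).neg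
    (x + ((S (k n)).1 - (S (k m)).1)) (t + ((S (k n)).2 - (S (k m)).2))
  rw [add_neg_cancel_right, add_neg_cancel_right] at h2
  rw [abs_le]; constructor <;> linarith

/-- Relative density of almost periods. -/
lemma gp_dense {N : ℕ} {Lt : AddSubgroup (Fin N → ℝ)} {g : (Fin N → ℝ) → ℝ → ℝ} (hg : GP Lt g)
    {ℓ : ℝ} (hred : ∀ x y : Fin N → ℝ, ∃ z ∈ Lt, ‖x + z - y‖ ≤ ℓ) {η : ℝ} (hη : 0 < η) :
    ∃ R ≥ 0, ∀ (x : Fin N → ℝ) (t : ℝ), ∃ z ∈ Lt, ∃ h, ‖z - x‖ ≤ R ∧ |h - t| ≤ R ∧ APer g η z h := by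
  have hfin : ∃ F : Finset ((Fin N → ℝ) × ℝ), (∀ γ ∈ F, γ.1 ∈ Lt) ∧
      ∀ γ : (Fin N → ℝ) × ℝ, γ.1 ∈ Lt → ∃ γ' ∈ F, APer g η (γ.1 - γ'.1) (γ.2 - γ'.2) := by
    by_contra hcon
    push Not at hcon
    obtain ⟨S, hS1, hS2⟩ := exists_seq_of_forall_finset_exists (fun γ : (Fin N → ℝ) × ℝ => γ.1 ∈ Lt)
      (fun γ' γ => ¬ APer g η (γ.1 - γ'.1) (γ.2 - γ'.2)) (fun F hF => hcon F hF)
    obtain ⟨k, hk, H⟩ := hg S hS1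
    obtain ⟨M, hM⟩ := H η hη
    exact hS2 (k M) (k (M + 1)) (hk (Nat.lt_succ_self M)) (hM (M + 1) (Nat.le_succ M) M le_rfl)
  obtain ⟨F, hF, hF2⟩ := hfin
  have hRF : ∃ R0 : ℝ, ∀ γ ∈ F, ‖γ‖ ≤ R0 := by
    obtain ⟨R0, h⟩ := (F.finite_toSet.image fun γ => ‖γ‖).bddAbove
    exact ⟨R0, fun γ hγ => h ⟨γ, hγ, rfl⟩⟩
  obtain ⟨R0, hR0⟩ := hRF
  have hℓ0 : 0 ≤ ℓ := by
    obtain ⟨z, _, hz⟩ := hred 0 0; exact (norm_nonneg _).trans hz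
  refine ⟨ℓ + |R0|, by positivity, fun x t => ?_⟩
  obtain ⟨z0, hz0, hzx⟩ := hred 0 x
  rw [zero_add] at hzx
  obtain ⟨γ', hγ', hap⟩ := hF2 (z0, t) hz0
  have hb := (hR0 γ' hγ').trans (le_abs_self R0)
  have hb1 : ‖γ'.1‖ ≤ |R0| := (norm_fst_le γ').trans hb
  have hb2 : ‖γ'.2‖ ≤ |R0| := (norm_snd_le γ').trans hb
  refine ⟨z0 - γ'.1, Lt.sub_mem hz0 (hF _ hγ'), t - γ'.2, ?_, ?_, hap⟩
  · calc ‖z0 - γ'.1 - x‖ = ‖(z0 - x) - γ'.1‖ := by congr 1; abel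
      _ ≤ ℓ + |R0| := (norm_sub_le _ _).trans (add_le_add hzx hb1)
  · rw [show t - γ'.2 - t = -γ'.2 by ring, abs_neg]
    rw [Real.norm_eq_abs] at hb2
    linarith

lemma ap_of_gp {N : ℕ} {Lt : AddSubgroup (Fin N → ℝ)} {u : (Fin N → ℝ) → ℝ → ℝ} (hg : GP Lt u)
    {ℓ : ℝ} (hred : ∀ x y : Fin N → ℝ, ∃ z ∈ Lt, ‖x + z - y‖ ≤ ℓ) (hm : SMod u)
    (hc : Continuous fun p : (Fin N → ℝ) × ℝ => u p.1 p.2) :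
    APfun fun p : (Fin N → ℝ) × ℝ => u p.1 p.2 := by
  refine ⟨hc, fun S => ?_⟩
  choose z hz hzl using fun n => hred (S n).1 0
  obtain ⟨k1, hk1, H⟩ := hg (fun n => (-(z n), (S n).2)) fun n => Lt.neg_mem (hz n)
  obtain ⟨r, _, k2, hk2, hr⟩ := (isCompact_closedBall (0 : Fin N → ℝ) ℓ).tendsto_subseq
    (x := fun n => (S (k1 n)).1 + z (k1 n)) (fun n => by
      have := hzl (k1 n)
      rwa [Metric.mem_closedBall, dist_eq_norm])
  refine ⟨k1 ∘ k2, hk1.comp hk2, ?_⟩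
  have hcauchy : ∀ ε > 0, ∃ M, ∀ n ≥ M, ∀ m ≥ M, ∀ X : (Fin N → ℝ) × ℝ,
      |u (X + S ((k1 ∘ k2) n)).1 (X + S ((k1 ∘ k2) n)).2
        - u (X + S ((k1 ∘ k2) m)).1 (X + S ((k1 ∘ k2) m)).2| ≤ ε := by
    intro ε hε
    obtain ⟨M1, hM1⟩ := H (ε / 2) (by linarith)
    obtain ⟨ρ, hρ, hmod⟩ := hm (ε / 2) (by linarith)
    obtain ⟨M2, hM2⟩ := Metric.cauchySeq_iff.1 hr.cauchySeq ρ hρ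
    refine ⟨max M1 M2, fun n hn m hm X => ?_⟩
    have a1 := hM1 (k2 n) (((le_max_left _ _).trans hn).trans hk2.le_apply) (k2 m)
      (((le_max_left _ _).trans hm).trans hk2.le_apply)
    have a2 := hM2 n ((le_max_right _ _).trans hn) m ((le_max_right _ _).trans hm)
    simp only [Function.comp] at a2 ⊢
    set i := k1 (k2 n)
    set j := k1 (k2 m)
    have b1 := pair_of_aper a1 (X.1 + ((S j).1 + z j)) X.2
    rw [dist_eq_norm] at a2
    have b2 := hmod (X.1 + (S i).1) (X.1 + ((S j).1 + z j) + -z i) (X.2 + (S i).2) (by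
      refine le_trans (le_of_eq ?_) a2.le
      congr 1; abel)
    simp only at b1
    rw [show X.1 + ((S j).1 + z j) + -z j = X.1 + (S j).1 by abel] at b1
    simp only [Prod.fst_add, Prod.snd_add]
    have b1 := abs_le.1 b1
    have b2 := abs_le.1 b2
    rw [abs_le]; constructor <;> linarith [b1.1, b1.2, b2.1, b2.2]
  have hlim : ∀ X : (Fin N → ℝ) × ℝ, ∃ y, Tendsto (fun n => u (X + S ((k1 ∘ k2) n)).1
      (X + S ((k1 ∘ k2) n)).2) atTop (𝓝 y) := by
    intro X
    refine cauchySeq_tendsto_of_complete (Metric.cauchySeq_iff.2 fun ε hε => ?_)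
    obtain ⟨M, hM⟩ := hcauchy (ε / 2) (by linarith)
    exact ⟨M, fun n hn m hm => by
      rw [Real.dist_eq]; exact (hM n hn m hm X).trans_lt (by linarith)⟩
  choose ψ hψ using hlim
  refine ⟨ψ, Metric.tendstoUniformly_iff.2 fun ε hε => ?_⟩
  obtain ⟨M, hM⟩ := hcauchy (ε / 2) (by linarith)
  filter_upwards [eventually_ge_atTop M] with n hn X
  have hl := (((hψ X).sub_const (u (X + S ((k1 ∘ k2) n)).1 (X + S ((k1 ∘ k2) n)).2))).abs
  rw [Real.dist_eq]
  refine lt_of_le_of_lt (le_of_tendsto hl ?_) (show ε / 2 < ε by linarith)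
  filter_upwards [eventually_ge_atTop M] with m hm
  exact hM m hm n hn X

lemma qOp_w {N : ℕ} {A : Fin N → Fin N → (Fin N → ℝ) → ℝ} {B : Fin N → (Fin N → ℝ) → ℝ}
    {Lt : AddSubgroup (Fin N → ℝ)} {ℓ : ℝ} (hP : PG A B Lt ℓ) {v : (Fin N → ℝ) → ℝ → ℝ}
    (hv : RegSol v) {z : Fin N → ℝ} (hz : z ∈ Lt) (h : ℝ) (x : Fin N → ℝ) (t : ℝ) :
    qOp A B (fun x t => trl v z h x t - v x t) x t = qOp A B v (x + z) (t + h) - qOp A B v x t := by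
  rw [qOp_sub A B (hv.trl z h).reg0 hv.reg0, qOp_trl v h (hP.hA z hz) (hP.hB z hz)]

lemma ap_star_pos {N : ℕ} {A : Fin N → Fin N → (Fin N → ℝ) → ℝ} {B : Fin N → (Fin N → ℝ) → ℝ}
    {a₀ CA CB : ℝ} (hQ : QC A B a₀ CA CB) {Lt : AddSubgroup (Fin N → ℝ)} {ℓ : ℝ}
    (hP : PG A B Lt ℓ) {v g : (Fin N → ℝ) → ℝ → ℝ} (hv : RegSol v) {K lam : ℝ}
    (hK : ∀ x t, |v x t| ≤ K) (hlam : 0 < lam) (hg : ∀ x t, qOp A B v x t + lam * v x t = g x t) :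
    ∀ ε > 0, ∃ η > 0, ∀ z ∈ Lt, ∀ h, APer g η z h → ∀ x t, -ε ≤ v (x + z) (t + h) - v x t := by
  intro ε hε
  refine ⟨lam * ε, by positivity, fun z hz h hap x t => ?_⟩
  have hr : RegSol (fun x t => v x t - trl v z h x t) := hv.sub (hv.trl z h)
  have := max_principle hQ hr (K := 2 * K) (G := lam * ε) (fun x t => by
      have h1 := abs_le.1 (hK x t)
      have h2 := abs_le.1 (hK (x + z) (t + h))
      simp only [trl]
      rw [abs_le]; constructor <;> linarith [h1.1, h1.2, h2.1, h2.2]) hlam (fun x t => by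
      rw [qOp_sub A B hv.reg0 (hv.trl z h).reg0, qOp_trl v h (hP.hA z hz) (hP.hB z hz)]
      have h1 := hg x t
      have h2 := hg (x + z) (t + h)
      have h3 := (abs_le.1 (hap x t)).1
      simp only [trl]
      linarith) x t
  have h4 := le_of_mul_le_mul_left this hlam
  simp only [trl] at h4
  linarith

lemma ap_star_zero {N : ℕ} {A : Fin N → Fin N → (Fin N → ℝ) → ℝ} {B : Fin N → (Fin N → ℝ) → ℝ}
    {a₀ CA CB : ℝ} (hQ : QC A B a₀ CA CB) {Lt : AddSubgroup (Fin N → ℝ)} {ℓ : ℝ}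
    (hP : PG A B Lt ℓ) {v g : (Fin N → ℝ) → ℝ → ℝ} (hv : RegSol v) {K : ℝ}
    (hK : ∀ x t, |v x t| ≤ K) (hm : SMod v) (hg : ∀ x t, qOp A B v x t = g x t) (hgp : GP Lt g) :
    ∀ ε > 0, ∃ η > 0, ∀ z ∈ Lt, ∀ h, APer g η z h → ∀ x t, -ε ≤ v (x + z) (t + h) - v x t := by
  intro ε' hε'
  set ε := ε' / 4 with hεd
  have hε : 0 < ε := by positivity
  set W : Set ((Fin N → ℝ) → ℝ → ℝ) :=
    {w | ∃ z ∈ Lt, ∃ h, w = fun x t => trl v z h x t - v x t} with hWd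
  have hW : Cls W (2 * K) := by
    refine ⟨?_, ?_, ?_⟩
    · rintro _ ⟨z, hz, h, rfl⟩
      exact (hv.trl z h).sub hv
    · rintro _ ⟨z, hz, h, rfl⟩ x t
      have h1 := abs_le.1 (hK x t)
      have h2 := abs_le.1 (hK (x + z) (t + h))
      simp only [trl]
      rw [abs_le]; constructor <;> linarith [h1.1, h1.2, h2.1, h2.2]
    · intro e he
      obtain ⟨ρ, hρ, hmod⟩ := hm (e / 2) (by linarith)
      refine ⟨ρ, hρ, ?_⟩
      rintro _ ⟨z, hz, h, rfl⟩ x y t hxy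
      have h1 := abs_le.1 (hmod x y t hxy)
      have h2 := abs_le.1 (hmod (x + z) (y + z) (t + h) (by simpa using hxy))
      simp only [trl]
      rw [abs_le]; constructor <;> linarith [h1.1, h1.2, h2.1, h2.2]
  have hmem : ∀ z ∈ Lt, ∀ h, (fun x t => trl v z h x t - v x t) ∈ W := fun z hz h => ⟨z, hz, h, rfl⟩
  have hqw : ∀ z ∈ Lt, ∀ h η, APer g η z h →
      ∀ x t, |qOp A B (fun x t => trl v z h x t - v x t) x t| ≤ η := by
    intro z hz h η hap x t
    rw [qOp_w hP hv hz, hg, hg]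
    exact hap x t
  have hbb : BddBelow (Set.range fun p : (Fin N → ℝ) × ℝ => v p.1 p.2) :=
    ⟨-K, by rintro _ ⟨p, rfl⟩; exact (abs_le.1 (hK _ _)).1⟩
  have hba : BddAbove (Set.range fun p : (Fin N → ℝ) × ℝ => v p.1 p.2) :=
    ⟨K, by rintro _ ⟨p, rfl⟩; exact (abs_le.1 (hK _ _)).2⟩
  set m := ⨅ p : (Fin N → ℝ) × ℝ, v p.1 p.2 with hmd
  set M := ⨆ p : (Fin N → ℝ) × ℝ, v p.1 p.2 with hMd
  have hmv : ∀ x t, m ≤ v x t := fun x t => ciInf_le hbb (x, t)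
  have hMv : ∀ x t, v x t ≤ M := fun x t => le_ciSup hba (x, t)
  obtain ⟨⟨x1, t1⟩, hX1⟩ := exists_lt_of_ciInf_lt (show m < m + ε by linarith)
  obtain ⟨⟨x2, t2⟩, hX2⟩ := exists_lt_of_lt_ciSup (show M - ε < M by linarith)
  simp only at hX1 hX2
  obtain ⟨η1, hη1, hosc1⟩ := liou_osc hQ hP hW (R := ‖x1 - x2‖ + |t1 - t2|) (by positivity) hε
  obtain ⟨R1, hR1, hden⟩ := gp_dense hgp hP.red hη1
  obtain ⟨η, hη, hosc⟩ := liou_osc hQ hP hW hR1 hε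
  refine ⟨η, hη, fun z hz h hap x t => ?_⟩
  obtain ⟨z', hz', h', hzx, hht, hap'⟩ := hden (x - x1) (t - t1)
  have k1 := hosc1 _ (hmem z' hz' h') (hqw z' hz' h' η1 hap') x1 x2 t1 t2
    (le_add_of_nonneg_right (abs_nonneg _)) (le_add_of_nonneg_left (norm_nonneg _))
  have k2 := hosc _ (hmem z hz h) (hqw z hz h η hap) (x1 + z') x (t1 + h') t
    (by rw [show x1 + z' - x = z' - (x - x1) by abel]; exact hzx)
    (by rw [show t1 + h' - t = h' - (t - t1) by ring]; exact hht)
  simp only [trl] at k1 k2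
  have k3 := hMv (x2 + z') (t2 + h')
  have k4 := hmv (x1 + z' + z) (t1 + h' + h)
  linarith

lemma const_of_nonneg {N : ℕ} {A : Fin N → Fin N → (Fin N → ℝ) → ℝ} {B : Fin N → (Fin N → ℝ) → ℝ}
    {a₀ CA CB : ℝ} (hQ : QC A B a₀ CA CB) {Lt : AddSubgroup (Fin N → ℝ)} {ℓ : ℝ}
    (hP : PG A B Lt ℓ) {v : (Fin N → ℝ) → ℝ → ℝ} (hv : RegSol v) {K : ℝ}
    (hK : ∀ x t, |v x t| ≤ K) (hm : SMod v) (hg : ∀ x t, 0 ≤ qOp A B v x t) (hgp : GP Lt v) :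
    ∃ k, ∀ x t, v x t = k := by
  have hbb : BddBelow (Set.range fun p : (Fin N → ℝ) × ℝ => v p.1 p.2) :=
    ⟨-K, by rintro _ ⟨p, rfl⟩; exact (abs_le.1 (hK _ _)).1⟩
  set m := ⨅ p : (Fin N → ℝ) × ℝ, v p.1 p.2 with hmd
  have hmv : ∀ x t, m ≤ v x t := fun x t => ciInf_le hbb (x, t)
  refine ⟨m, fun y s => le_antisymm (le_of_forall_pos_le_add fun ε' hε' => ?_) (hmv y s)⟩
  set ε := ε' / 3 with hεd
  have hε : 0 < ε := by positivity
  obtain ⟨ρ, hρ, hmod⟩ := hm ε hε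
  obtain ⟨R, hR, hden⟩ := gp_dense hgp hP.red hε
  obtain ⟨δ, hδ, hprop⟩ := propagate hQ hρ (R := R) (T := 2 * R + 1) hR (by positivity) hε
  obtain ⟨⟨x0, t0⟩, hX0⟩ := exists_lt_of_ciInf_lt (show m < m + δ by linarith)
  simp only at hX0
  obtain ⟨z, hz, h, hzx, hht, hap⟩ := hden (x0 - y) (t0 - 1 - R - s)
  have hht := abs_le.1 hht
  obtain ⟨x', hx', hlt⟩ := hprop (fun x t => v x t - m) (hv.sub (regSol_const m)) x0 t0
    (fun x t _ _ _ => by linarith [hmv x t])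
    (fun x t _ _ _ => by
      rw [qOp_sub A B hv.reg0 (reg0_const m), qOp_const]
      linarith [hg x t])
    (by linarith) (y + z) (s + h)
    (by rw [show y + z - x0 = z - (x0 - y) by abel]; exact hzx)
    (by linarith [hht.1]) (by linarith [hht.2])
  have k1 := (abs_le.1 (hmod x' (y + z) (s + h) hx')).1
  have k2 := (abs_le.1 (hap y s)).1
  linarith

lemma pd2_mul {N : ℕ} {φ ψ : (Fin N → ℝ) → ℝ} (h1 : ContDiff ℝ 2 φ) (h2 : ContDiff ℝ 2 ψ)
    (i j : Fin N) (x : Fin N → ℝ) :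
    pd2 i j (fun y => φ y * ψ y) x
      = pd2 i j φ x * ψ x + pd j φ x * pd i ψ x + (pd i φ x * pd j ψ x + φ x * pd2 i j ψ x) := by
  have h1' : ContDiff ℝ 1 φ := h1.of_le (by norm_num)
  have h2' : ContDiff ℝ 1 ψ := h2.of_le (by norm_num)
  unfold pd2
  have e : (fun y => pd j (fun y => φ y * ψ y) y) = fun y => pd j φ y * ψ y + φ y * pd j ψ y := by
    ext y; exact pd_mul h1' h2' j y
  rw [e, pd_add ((pd_contDiff h1 j).mul h2') (h1'.mul (pd_contDiff h2 j)),
    pd_mul (pd_contDiff h1 j) h2', pd_mul h1' (pd_contDiff h2 j)]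

/-- Transformed drift. -/
def Bt {N : ℕ} (A : Fin N → Fin N → (Fin N → ℝ) → ℝ) (B : Fin N → (Fin N → ℝ) → ℝ)
    (φ : (Fin N → ℝ) → ℝ) (i : Fin N) (x : Fin N → ℝ) : ℝ :=
  B i x + 2 * ∑ j, A i j x * pd j φ x / φ x

lemma conj_eq {N : ℕ} {A : Fin N → Fin N → (Fin N → ℝ) → ℝ} {B : Fin N → (Fin N → ℝ) → ℝ}
    {C : (Fin N → ℝ) → ℝ} (hsymm : ∀ i j x, A i j x = A j i x) {φ : (Fin N → ℝ) → ℝ}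
    (hφ : ContDiff ℝ 2 φ) (hpos : ∀ x, 0 < φ x) {lam : ℝ}
    (heig : ∀ x, -(ellOp A B C φ x) = lam * φ x) {v : (Fin N → ℝ) → ℝ → ℝ} (hv : RegSol v)
    (x : Fin N → ℝ) (t : ℝ) :
    parOp (fun i j x _ => A i j x) (fun i x _ => B i x) (fun x _ => C x)
      (fun x t => v x t * φ x) x t = φ x * (qOp A (Bt A B φ) v x t + lam * v x t) := by
  have h1' : ContDiff ℝ 1 (fun y => v y t) := (hv.2.2 t).of_le (by norm_num)
  have h2' : ContDiff ℝ 1 φ := hφ.of_le (by norm_num)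
  unfold parOp qOp
  have ed : deriv (fun s => v x s * φ x) t = deriv (fun s => v x s) t * φ x :=
    deriv_mul_const (hv.2.1 x t) _
  have e := heig x
  unfold ellOp at e
  simp only [ed, pd2_mul (hv.2.2 t) hφ, pd_mul h1' h2']
  have hne := (hpos x).ne'
  set p : Fin N → ℝ := fun i => pd i (fun y => v y t) x with hp
  set q : Fin N → ℝ := fun i => pd i φ x with hq
  have hcross : ∑ i, ∑ j, A i j x * (p j * q i) = ∑ i, ∑ j, A i j x * (p i * q j) := by
    rw [Finset.sum_comm]
    exact Finset.sum_congr rfl fun i _ => Finset.sum_congr rfl fun j _ => by rw [hsymm]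
  have e1 : ∑ i, ∑ j, A i j x * (pd2 i j (fun y => v y t) x * φ x + p j * q i
        + (p i * q j + v x t * pd2 i j φ x))
      = φ x * ∑ i, ∑ j, A i j x * pd2 i j (fun y => v y t) x
        + 2 * (∑ i, ∑ j, A i j x * (p i * q j)) + v x t * ∑ i, ∑ j, A i j x * pd2 i j φ x := by
    rw [two_mul]
    nth_rw 1 [← hcross]
    simp only [Finset.mul_sum, ← Finset.sum_add_distrib]
    refine Finset.sum_congr rfl fun i _ => Finset.sum_congr rfl fun j _ => ?_
    ring
  have e2 : ∑ i, B i x * (p i * φ x + v x t * q i)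
      = φ x * (∑ i, B i x * p i) + v x t * ∑ i, B i x * q i := by
    simp only [Finset.mul_sum, ← Finset.sum_add_distrib]
    exact Finset.sum_congr rfl fun i _ => by ring
  have e3 : φ x * ∑ i, Bt A B φ i x * p i
      = φ x * (∑ i, B i x * p i) + 2 * ∑ i, ∑ j, A i j x * (p i * q j) := by
    unfold Bt
    simp only [Finset.mul_sum, ← Finset.sum_add_distrib, add_mul, Finset.sum_mul, mul_add]
    refine Finset.sum_congr rfl fun i _ => ?_
    congr 1
    refine Finset.sum_congr rfl fun j _ => ?_
    simp only [hq]
    field_simp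
  have e0 : v x t * ((∑ i, ∑ j, A i j x * pd2 i j φ x) + (∑ i, B i x * q i) + C x * φ x)
      = - (lam * φ x * v x t) := by
    rw [show lam * φ x = _ from e.symm]; ring
  rw [e1, e2]
  linear_combination (-1 : ℝ) * e0 + e3

/-- The period lattice. -/
def PLat {N : ℕ} (l : Fin N → ℝ) : AddSubgroup (Fin N → ℝ) :=
  AddSubgroup.closure (Set.range fun i => Pi.single i (l i))

lemma lat_per {N : ℕ} {l : Fin N → ℝ} {α : Type*} {ψ : (Fin N → ℝ) → α}
    (h : ∀ (i : Fin N) (x : Fin N → ℝ), ψ (x + Pi.single i (l i)) = ψ x) :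
    ∀ z ∈ PLat l, ∀ x, ψ (x + z) = ψ x := by
  intro z hz
  induction hz using AddSubgroup.closure_induction with
  | mem z hz => obtain ⟨i, rfl⟩ := hz; exact h i
  | zero => simp
  | add a b _ _ ha hb => intro x; rw [← add_assoc, hb, ha]
  | neg a _ ha => intro x; rw [← ha (x + -a), neg_add_cancel_right]

lemma lat_red {N : ℕ} {l : Fin N → ℝ} (hl : ∀ i, 0 < l i) (x y : Fin N → ℝ) :
    ∃ z ∈ PLat l, ‖x + z - y‖ ≤ ∑ i, l i := by
  refine ⟨∑ i, ⌊(y i - x i) / l i⌋ • Pi.single i (l i), ?_, ?_⟩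
  · refine AddSubgroup.sum_mem _ fun i _ => AddSubgroup.zsmul_mem _ ?_ _
    unfold PLat
    exact AddSubgroup.subset_closure ⟨i, rfl⟩
  · have hs : 0 ≤ ∑ i, l i := Finset.sum_nonneg fun i _ => (hl i).le
    rw [pi_norm_le_iff_of_nonneg hs]
    intro i
    have e : (∑ j, ⌊(y j - x j) / l j⌋ • (Pi.single j (l j) : Fin N → ℝ)) i
        = ⌊(y i - x i) / l i⌋ * l i := by
      rw [Finset.sum_apply, Finset.sum_eq_single i]
      · simp
      · intro j _ hj; simp [Pi.single_eq_of_ne (Ne.symm hj)]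
      · simp
    rw [Pi.sub_apply, Pi.add_apply, e]
    have hli := hl i
    have h1 := Int.floor_le ((y i - x i) / l i)
    have h2 := Int.lt_floor_add_one ((y i - x i) / l i)
    rw [le_div_iff₀ hli] at h1
    rw [div_lt_iff₀ hli] at h2
    have h3 : l i ≤ ∑ i, l i := Finset.single_le_sum (f := l) (fun i _ => (hl i).le) (Finset.mem_univ i)
    rw [Real.norm_eq_abs, abs_le]
    constructor <;> linarith

lemma per_bdd {N : ℕ} {l : Fin N → ℝ} (hl : ∀ i, 0 < l i) {ψ : (Fin N → ℝ) → ℝ} (hc : Continuous ψ)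
    (hper : ∀ z ∈ PLat l, ∀ x, ψ (x + z) = ψ x) : ∃ c, ∀ x, |ψ x| ≤ c := by
  obtain ⟨c, hcb⟩ := (isCompact_closedBall (0 : Fin N → ℝ) (∑ i, l i)).exists_bound_of_continuousOn
    hc.continuousOn
  refine ⟨c, fun x => ?_⟩
  obtain ⟨z, hz, hzl⟩ := lat_red hl x 0
  rw [← hper z hz x]
  exact hcb _ (by rwa [Metric.mem_closedBall, dist_eq_norm])

lemma unif_bdd {ι X : Type*} [Fintype ι] {F : ι → X → ℝ} (h : ∀ i, ∃ c, ∀ x, |F i x| ≤ c) :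
    ∃ c, 0 ≤ c ∧ ∀ i x, |F i x| ≤ c := by
  choose c hc using h
  refine ⟨∑ i, |c i|, Finset.sum_nonneg fun _ _ => abs_nonneg _, fun i x => ?_⟩
  exact ((hc i x).trans (le_abs_self _)).trans
    (Finset.single_le_sum (f := fun i => |c i|) (fun _ _ => abs_nonneg _) (Finset.mem_univ i))

lemma unif_mod {N : ℕ} {A : Fin N → Fin N → (Fin N → ℝ) → ℝ}
    (h : ∀ i j, UniformContinuous (A i j)) :
    ∀ μ > 0, ∃ r > 0, ∀ x y i j, nn y x ≤ r ^ 2 → |A i j y - A i j x| ≤ μ := by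
  intro μ hμ
  have hF : UniformContinuous (fun x => fun i j => A i j x) :=
    uniformContinuous_pi.2 fun i => uniformContinuous_pi.2 fun j => h i j
  obtain ⟨δ, hδ, H⟩ := Metric.uniformContinuous_iff.1 hF μ hμ
  refine ⟨δ / 2, by linarith, fun x y i j hxy => ?_⟩
  have h1 : ‖x - y‖ ≤ δ / 2 := norm_le_of_nn (by linarith) hxy
  have h2 := (H (a := y) (b := x) (by rw [dist_comm, dist_eq_norm]; linarith)).le
  have h3 := (dist_le_pi_dist (fun i j => A i j y) (fun i j => A i j x) i).trans h2
  have h4 := (dist_le_pi_dist (fun j => A i j y) (fun j => A i j x) j).trans h3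
  rwa [Real.dist_eq] at h4

lemma SMod.mul {N : ℕ} {v : (Fin N → ℝ) → ℝ → ℝ} {φ : (Fin N → ℝ) → ℝ} {K c D : ℝ}
    (hv : SMod v) (hK : ∀ x t, |v x t| ≤ K) (hc : ∀ x, |φ x| ≤ c)
    (hD : ∀ x y, |φ x - φ y| ≤ D * ‖x - y‖) : SMod (fun x t => v x t * φ x) := by
  intro ε hε
  have hK0 : 0 ≤ K := (abs_nonneg _).trans (hK 0 0)
  have hc0 : 0 ≤ c := (abs_nonneg _).trans (hc 0)
  obtain ⟨ρ, hρ, hmod⟩ := hv (ε / (2 * (c + 1))) (by positivity)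
  refine ⟨min ρ (ε / (2 * (K + 1) * (|D| + 1))), by positivity, fun x y t hxy => ?_⟩
  have h1 := hmod x y t (hxy.trans (min_le_left _ _))
  have h2 : |φ x - φ y| ≤ ε / (2 * (K + 1)) := by
    refine (hD x y).trans ?_
    calc D * ‖x - y‖ ≤ (|D| + 1) * (ε / (2 * (K + 1) * (|D| + 1))) := by
          refine mul_le_mul (by linarith [le_abs_self D]) (hxy.trans (min_le_right _ _))
            (norm_nonneg _) (by positivity)
      _ = ε / (2 * (K + 1)) := by field_simp
  have e : v x t * φ x - v y t * φ y = (v x t - v y t) * φ x + v y t * (φ x - φ y) := by ring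
  beta_reduce
  rw [e]
  refine (abs_add_le _ _).trans ?_
  rw [abs_mul, abs_mul]
  have k1 : |v x t - v y t| * |φ x| ≤ ε / (2 * (c + 1)) * (c + 1) :=
    mul_le_mul h1 ((hc x).trans (by linarith)) (abs_nonneg _) (by positivity)
  have k2 : |v y t| * |φ x - φ y| ≤ (K + 1) * (ε / (2 * (K + 1))) :=
    mul_le_mul ((hK y t).trans (by linarith)) h2 (abs_nonneg _) (by positivity)
  have k3 : ε / (2 * (c + 1)) * (c + 1) = ε / 2 := by field_simp
  have k4 : (K + 1) * (ε / (2 * (K + 1))) = ε / 2 := by field_simp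
  linarith

/-- **Theorem 1.6.**  Let `P = ∂ₜ − L` with `L` periodic, `c` continuous, and let
`f` be almost periodic.  If `u` is a bounded solution of `P u = f` then:
(i) if `λₚ(−L) ≥ 0` then `u` is almost periodic; (ii) if `λₚ(−L) = 0` and `f ≤ 0`
or `f ≥ 0` everywhere then `u ≡ k φₚ` for some `k ∈ ℝ` and `f ≡ 0`. -/
theorem thm_ap {N : ℕ}
    (A : Fin N → Fin N → (Fin N → ℝ) → ℝ)
    (B : Fin N → (Fin N → ℝ) → ℝ) (C : (Fin N → ℝ) → ℝ)
    (f u : (Fin N → ℝ) → ℝ → ℝ) (l : Fin N → ℝ)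
    (hl : ∀ i, 0 < l i)
    (hstd : StdCoeffs (fun i j x _ => A i j x) (fun i x _ => B i x) (fun x _ => C x))
    (hCcont : Continuous C)
    (hAper : ∀ i j, PerSpaceFun l (A i j))
    (hBper : ∀ i, PerSpaceFun l (B i))
    (hCper : PerSpaceFun l C)
    (hfap : APfun fun p : (Fin N → ℝ) × ℝ => f p.1 p.2)
    (lam : ℝ) (φp : (Fin N → ℝ) → ℝ)
    (heig : IsPerPrincipal A B C l lam φp)
    (hsol : IsSol (fun i j x _ => A i j x) (fun i x _ => B i x) (fun x _ => C x) f u)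
    (hbdd : Bdd2 u) :
    (0 ≤ lam → APfun fun p : (Fin N → ℝ) × ℝ => u p.1 p.2) ∧
    (lam = 0 → ((∀ x t, f x t ≤ 0) ∨ (∀ x t, 0 ≤ f x t)) →
      (∃ k : ℝ, ∀ x t, u x t = k * φp x) ∧ (∀ x t, f x t = 0)) := by
  obtain ⟨hφ2, hφpos, hφper, hφeig⟩ := heig
  obtain ⟨hAb, hAuc, hBb, hBuc, -, -, hsymm', a₀, a₁, ha₀, -, hell⟩ := hstd
  obtain ⟨hur, hueq⟩ := hsol
  obtain ⟨Ku, hKu⟩ := hbdd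
  have hsymm : ∀ i j x, A i j x = A j i x := fun i j x => hsymm' i j x 0
  have hpair : UniformContinuous (fun x : Fin N → ℝ => (x, (0:ℝ))) :=
    uniformContinuous_id.prodMk uniformContinuous_const
  have hAu : ∀ i j, UniformContinuous (A i j) := fun i j => (hAuc i j).comp hpair
  have hBu : ∀ i, UniformContinuous (B i) := fun i => (hBuc i).comp hpair
  have hφc : Continuous φp := hφ2.continuous
  have hne : ∀ x, φp x ≠ 0 := fun x => (hφpos x).ne'
  have hpdc : ∀ i, Continuous (fun x => pd i φp x) := fun i => (pd_contDiff hφ2 i).continuous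
  -- periodicity along the lattice
  have pA : ∀ z ∈ PLat l, ∀ i j x, A i j (x + z) = A i j x :=
    fun z hz i j => lat_per (hAper i j) z hz
  have pB : ∀ z ∈ PLat l, ∀ i x, B i (x + z) = B i x := fun z hz i => lat_per (hBper i) z hz
  have pφ : ∀ z ∈ PLat l, ∀ x, φp (x + z) = φp x := lat_per hφper
  have pd' : ∀ z ∈ PLat l, ∀ i x, pd i φp (x + z) = pd i φp x := by
    intro z hz i x
    rw [← pd_trl φp z i x]
    congr 1
    ext y; exact pφ z hz y
  have pBt : ∀ z ∈ PLat l, ∀ i x, Bt A B φp i (x + z) = Bt A B φp i x := by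
    intro z hz i x
    unfold Bt
    simp only [pA z hz, pB z hz, pφ z hz, pd' z hz]
  have hP : PG A (Bt A B φp) (PLat l) (∑ i, l i) :=
    ⟨pA, pBt, Finset.sum_nonneg fun i _ => (hl i).le, lat_red hl⟩
  -- bounds
  obtain ⟨CA, hCA0, hCA⟩ := unif_bdd (F := fun (ij : Fin N × Fin N) x => A ij.1 ij.2 x)
    fun ij => per_bdd hl (hAu ij.1 ij.2).continuous fun z hz x => pA z hz _ _ x
  obtain ⟨CB, hCB0, hCB⟩ := unif_bdd (F := Bt A B φp) fun i => per_bdd hl (by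
    unfold Bt
    refine (hBu i).continuous.add (continuous_const.mul (continuous_finsetSum _ fun j _ => ?_))
    exact ((hAu i j).continuous.mul (hpdc j)).div hφc hne) fun z hz x => pBt z hz i x
  have hQ : QC A (Bt A B φp) a₀ CA CB :=
    { pos := ha₀, symm := hsymm, ell := fun x ξ => (hell x 0 ξ).1,
      bA := fun i j x => hCA (i, j) x, bB := hCB, CA0 := hCA0, CB0 := hCB0 }
  obtain ⟨c1, hc1⟩ := per_bdd hl hφc pφ
  obtain ⟨c2, hc2⟩ := per_bdd hl (ψ := fun x => (φp x)⁻¹) (hφc.inv₀ hne)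
    (fun z hz x => by simp only [pφ z hz])
  have hLip : ∃ D : ℝ, ∀ x y, |φp x - φp y| ≤ D * ‖x - y‖ := by
    obtain ⟨D, hD⟩ := per_bdd hl (ψ := fun x => ‖fderiv ℝ φp x‖)
      (hφ2.continuous_fderiv (by norm_num)).norm (fun z hz x => by
        rw [← fderiv_comp_add_right z]
        simp only [pφ z hz])
    refine ⟨D, fun x y => ?_⟩
    have := convex_univ.norm_image_sub_le_of_norm_fderiv_le (𝕜 := ℝ) (f := φp) (C := D) (x := y) (y := x)
      (fun x _ => (hφ2.differentiable (by norm_num)) x)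
      (fun x _ => by have := hD x; rwa [abs_norm] at this) (Set.mem_univ _) (Set.mem_univ _)
    rwa [Real.norm_eq_abs] at this
  obtain ⟨D, hD⟩ := hLip
  -- the conjugated unknown
  set v : (Fin N → ℝ) → ℝ → ℝ := fun x t => u x t * (φp x)⁻¹ with hv
  set g : (Fin N → ℝ) → ℝ → ℝ := fun x t => f x t * (φp x)⁻¹ with hg
  have hinv : ContDiff ℝ 2 (fun x => (φp x)⁻¹) := hφ2.inv hne
  have hvr : RegSol v := by
    refine ⟨?_, fun x => ?_, fun t => ?_⟩
    · exact hur.1.mul (hinv.continuous.comp continuous_fst)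
    · exact (hur.2.1 x).mul_const _
    · exact (hur.2.2 t).mul hinv
  have huv : ∀ x t, u x t = v x t * φp x := fun x t => by
    simp only [hv]; rw [inv_mul_cancel_right₀ (hne x)]
  have hvK : ∀ x t, |v x t| ≤ Ku * c2 := fun x t => by
    simp only [hv]; rw [abs_mul]
    exact mul_le_mul (hKu x t) (hc2 x) (abs_nonneg _) ((abs_nonneg _).trans (hKu x t))
  have hveq : ∀ x t, qOp A (Bt A B φp) v x t + lam * v x t = g x t := by
    intro x t
    have h1 := conj_eq hsymm hφ2 hφpos hφeig hvr x t
    have h2 : (fun x t => v x t * φp x) = u := by ext x t; exact (huv x t).symm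
    rw [h2, hueq x t] at h1
    simp only [hg]
    rw [h1]; field_simp [hne x]
  obtain ⟨Gf, hGf⟩ := ap_bdd hfap
  have hqb : ∀ x t, |qOp A (Bt A B φp) v x t| ≤ Gf * c2 + |lam| * (Ku * c2) := by
    intro x t
    rw [show qOp A (Bt A B φp) v x t = g x t - lam * v x t by rw [← hveq x t]; ring]
    refine (abs_sub _ _).trans (add_le_add ?_ ?_)
    · simp only [hg]; rw [abs_mul]
      exact mul_le_mul (hGf x t) (hc2 x) (abs_nonneg _) ((abs_nonneg _).trans (hGf x t))
    · rw [abs_mul]; exact mul_le_mul_of_nonneg_left (hvK x t) (abs_nonneg _)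
  have hvm : SMod v := smod_of_holder (holder hQ (unif_mod hAu) hvr hvK hqb)
  have hgp : GP (PLat l) g := (gp_of_ap (PLat l) hfap).mul hc2 fun z hz x => by rw [pφ z hz]
  have hgv : 0 ≤ lam → GP (PLat l) v := by
    intro hlam
    refine gp_star hgp ?_
    rcases hlam.eq_or_lt with h0 | h0
    · refine ap_star_zero hQ hP hvr hvK hvm (fun x t => ?_) hgp
      have := hveq x t
      rw [← h0, zero_mul, add_zero] at this
      exact this
    · exact ap_star_pos hQ hP hvr hvK h0 hveq
  refine ⟨fun hlam => ?_, fun hlam hsign => ?_⟩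
  · have hu' : u = fun x t => v x t * φp x := by ext x t; exact huv x t
    have h1 : GP (PLat l) u := by rw [hu']; exact (hgv hlam).mul hc1 pφ
    have h2 : SMod u := by rw [hu']; exact hvm.mul hvK hc1 hD
    exact ap_of_gp h1 (lat_red hl) h2 hur.1
  · have hq0 : ∀ x t, qOp A (Bt A B φp) v x t = g x t := by
      intro x t
      have := hveq x t
      rw [hlam, zero_mul, add_zero] at this
      exact this
    have hconst : ∃ k, ∀ x t, v x t = k := by
      rcases hsign with hs | hs
      · have hr : RegSol (fun x t => 0 - v x t) := (regSol_const 0).sub hvr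
        obtain ⟨k, hk⟩ := const_of_nonneg hQ hP hr (K := Ku * c2)
          (fun x t => by rw [zero_sub, abs_neg]; exact hvK x t)
          (fun ε hε => by
            obtain ⟨ρ, hρ, H⟩ := hvm ε hε
            refine ⟨ρ, hρ, fun x y t hxy => ?_⟩
            have := H x y t hxy
            rw [abs_sub_comm] at this
            rwa [show (0 - v x t) - (0 - v y t) = v y t - v x t by ring])
          (fun x t => by
            rw [qOp_const_sub A _ hvr, hq0 x t]
            have := mul_nonneg_of_nonpos_of_nonpos (hs x t) (show -(φp x)⁻¹ ≤ 0 by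
              have := inv_pos.2 (hφpos x); linarith)
            simp only [hg]; linarith)
          (by
            have := (hgv hlam.ge).mul (ψ := fun _ => (-1:ℝ)) (c := 1) (by simp) (by simp)
            refine (congrArg (GP (PLat l)) ?_).mp this
            ext x t; ring)
        exact ⟨-k, fun x t => by linarith [hk x t]⟩
      · refine const_of_nonneg hQ hP hvr hvK hvm (fun x t => ?_) (hgv hlam.ge)
        rw [hq0 x t]
        exact mul_nonneg (hs x t) (inv_pos.2 (hφpos x)).le
    obtain ⟨k, hk⟩ := hconst
    refine ⟨⟨k, fun x t => by rw [huv, hk]⟩, fun x t => ?_⟩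
    have h1 := hq0 x t
    have h2 : v = fun _ _ => k := by ext x t; exact hk x t
    rw [h2, qOp_const] at h1
    have h3 : f x t * (φp x)⁻¹ = 0 := h1.symm
    rcases mul_eq_zero.1 h3 with h4 | h4
    · exact h4
    · exact absurd (inv_eq_zero.1 h4) (hne x)
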